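/- arXiv:2008.08897 — 3 statements merged into one kernel-verified Lean document; each statement's English description precedes it below -/
import Mathlib

section
/- Variation norm bounded via stopped suprema: let (Π_{s,t})_{s ≤ t} be a discrete-time adapted process with Π_{t,t}=0 for all t. Then for every 0 < ρ < r < ∞ and q ∈ (0,∞], the L^q norm of V^rΠ is bounded, up to a constant depending on ρ, r, q, by the supremum over all adapted partitions (τ_j) of the L^q norm of (Σ_{j=1}^{∞} (sup_{τ_{j-1} ≤ t < t' ≤ τ_j} |Π_{t,t'}|)^ρ)^{1/ρ}. -/
open MeasureTheory ENNReal

/-- The `L^q` "norm" (for `q ∈ (0,∞]`) of an `ℝ≥0∞`-valued function. -/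
noncomputable def lqNorm {Ω : Type*} [MeasurableSpace Ω] (μ : Measure Ω) (q : ℝ≥0∞)
    (f : Ω → ℝ≥0∞) : ℝ≥0∞ :=
  if q = ∞ then essSup f μ else (∫⁻ ω, f ω ^ q.toReal ∂μ) ^ (1 / q.toReal)

/-- The `r`-variation of a discrete-time two-parameter process. -/
noncomputable def VvarN (r : ℝ) (P : ℕ → ℕ → ℝ) : ℝ≥0∞ :=
  ⨆ (L : ℕ) (u : Fin (L + 1) → ℕ) (_ : Monotone u),
    (∑ l : Fin L, (ENNReal.ofReal |P (u l.castSucc) (u l.succ)|) ^ r) ^ (1 / r)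

/-- The dyadic weight `2 ^ (-n β)`. -/
noncomputable def dyadicWeight (β : ℝ) (n : ℕ) : ℝ≥0∞ := 2 ^ (-(n * β))

theorem dyadicWeight_eq_pow (β : ℝ) (n : ℕ) : dyadicWeight β n = (2 ^ (-β)) ^ n := by
  rw [dyadicWeight, ← ENNReal.rpow_natCast, ← ENNReal.rpow_mul]
  congr 1
  ring

theorem dyadicWeight_zero (β : ℝ) : dyadicWeight β 0 = 1 := by
  simp [dyadicWeight]

theorem dyadicWeight_rpow (β γ : ℝ) (n : ℕ) :
    dyadicWeight β n ^ γ = dyadicWeight (β * γ) n := by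
  rw [dyadicWeight, dyadicWeight, ← ENNReal.rpow_mul]
  congr 1
  ring

theorem dyadicWeight_mul (β γ : ℝ) (n : ℕ) :
    dyadicWeight β n * dyadicWeight γ n = dyadicWeight (β + γ) n := by
  rw [dyadicWeight, dyadicWeight, dyadicWeight, ← ENNReal.rpow_add _ _ (by simp) (by simp)]
  congr 1
  ring

theorem dyadicWeight_succ (β : ℝ) (n : ℕ) :
    dyadicWeight β (n + 1) = 2 ^ (-β) * dyadicWeight β n := by
  rw [dyadicWeight_eq_pow, dyadicWeight_eq_pow, pow_succ']

theorem two_rpow_neg_lt_one {β : ℝ} (hβ : 0 < β) : (2 : ℝ≥0∞) ^ (-β) < 1 :=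
  ENNReal.rpow_lt_one_of_one_lt_of_neg (by norm_num) (by linarith)

theorem tsum_dyadicWeight_lt_top {β : ℝ} (hβ : 0 < β) : ∑' n, dyadicWeight β n < ∞ := by
  simp_rw [dyadicWeight_eq_pow]
  rw [ENNReal.tsum_geometric, ENNReal.inv_lt_top, tsub_pos_iff_lt]
  exact two_rpow_neg_lt_one hβ

theorem exists_dyadic_level {x M : ℝ≥0∞} (hx : x ≠ 0) (hxM : x ≤ M) (hM : M ≠ ∞) :
    ∃ m : ℕ, dyadicWeight 1 (m + 1) * M < x ∧ x ≤ dyadicWeight 1 m * M := by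
  have hlim : Filter.Tendsto (fun n : ℕ => dyadicWeight 1 n * M) Filter.atTop (nhds 0) := by
    have h := ENNReal.Tendsto.mul_const (b := M)
      (ENNReal.tendsto_pow_atTop_nhds_zero_of_lt_one (two_rpow_neg_lt_one one_pos)) (Or.inr hM)
    simpa [dyadicWeight_eq_pow] using h
  have hex : ∃ n : ℕ, dyadicWeight 1 n * M < x :=
    (hlim.eventually (gt_mem_nhds (pos_iff_ne_zero.2 hx))).exists
  classical
  obtain ⟨m, hm⟩ : ∃ m, Nat.find hex = m + 1 := by
    refine Nat.exists_eq_succ_of_ne_zero fun h0 => ?_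
    have h := Nat.find_spec hex
    rw [h0, dyadicWeight_zero, one_mul] at h
    exact absurd hxM (not_le.2 h)
  refine ⟨m, hm ▸ Nat.find_spec hex, not_lt.1 (Nat.find_min hex ?_)⟩
  omega

/-- The first time `t` that closes a pair `s < t` satisfying `B` and starting no earlier
than `x`. -/
noncomputable def nextTime (B : ℕ → ℕ → Prop) (x : ℕ∞) : ℕ∞ :=
  sInf ((fun t : ℕ => (t : ℕ∞)) '' {t | ∃ s < t, x ≤ s ∧ B s t})

theorem nextTime_le_iff {B : ℕ → ℕ → Prop} {x : ℕ∞} {n : ℕ} :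
    nextTime B x ≤ n ↔ ∃ t ≤ n, ∃ s < t, x ≤ s ∧ B s t := by
  constructor
  · intro h
    have hne : ((fun t : ℕ => (t : ℕ∞)) '' {t | ∃ s < t, x ≤ s ∧ B s t}).Nonempty := by
      by_contra hne
      rw [nextTime, Set.not_nonempty_iff_eq_empty.1 hne, sInf_empty] at h
      exact absurd h (by simp)
    obtain ⟨t, ht, hte⟩ := csInf_mem hne
    refine ⟨t, ?_, ht⟩
    have h' : (t : ℕ∞) ≤ n := by
      rw [nextTime, ← hte] at h
      exact h
    exact_mod_cast h'
  · rintro ⟨t, htn, ht⟩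
    exact (sInf_le (Set.mem_image_of_mem (fun t : ℕ => (t : ℕ∞)) ht)).trans (Nat.cast_le.2 htn)

theorem exists_of_nextTime_eq {B : ℕ → ℕ → Prop} {x : ℕ∞} {n : ℕ} (h : nextTime B x = n) :
    ∃ s < n, x ≤ s ∧ B s n := by
  obtain ⟨t, htn, ht⟩ := nextTime_le_iff.1 h.le
  have hle : nextTime B x ≤ t := nextTime_le_iff.2 ⟨t, le_rfl, ht⟩
  rw [h] at hle
  obtain rfl : t = n := le_antisymm htn (by exact_mod_cast hle)
  exact ht

theorem add_one_le_nextTime (B : ℕ → ℕ → Prop) (x : ℕ∞) : x + 1 ≤ nextTime B x := by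
  induction h : nextTime B x using ENat.recTopCoe with
  | top => exact le_top
  | coe n =>
    obtain ⟨s, hs, hxs, -⟩ := exists_of_nextTime_eq h
    calc x + 1 ≤ (s : ℕ∞) + 1 := by gcongr
      _ ≤ n := by exact_mod_cast hs

/-- The successive times obtained by iterating `nextTime` from `0`. -/
noncomputable def hitTimes (B : ℕ → ℕ → Prop) : ℕ → ℕ∞
  | 0 => 0
  | j + 1 => nextTime B (hitTimes B j)

theorem hitTimes_le_succ (B : ℕ → ℕ → Prop) (j : ℕ) : hitTimes B j ≤ hitTimes B (j + 1) :=
  le_self_add.trans (add_one_le_nextTime B _)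

theorem natCast_le_hitTimes (B : ℕ → ℕ → Prop) (j : ℕ) : (j : ℕ∞) ≤ hitTimes B j := by
  induction j with
  | zero => simp
  | succ j ih =>
    push_cast
    exact (add_le_add_left ih 1).trans (add_one_le_nextTime B _)

theorem iSup_hitTimes (B : ℕ → ℕ → Prop) : ⨆ j, hitTimes B j = ⊤ := by
  refine ENat.eq_top_iff_forall_ge.2 fun n => ?_
  exact (natCast_le_hitTimes B n).trans (le_iSup (hitTimes B) n)

theorem exists_hitTimes_mem {B : ℕ → ℕ → Prop} {s t : ℕ} (hst : s < t) (hB : B s t) :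
    ∃ j, hitTimes B j ≤ s ∧ (s : ℕ∞) < hitTimes B (j + 1) ∧ hitTimes B (j + 1) ≤ t := by
  have hex : ∃ k, (s : ℕ∞) < hitTimes B k :=
    ⟨s + 1, lt_of_lt_of_le (by exact_mod_cast s.lt_succ_self) (natCast_le_hitTimes B (s + 1))⟩
  classical
  obtain ⟨j, hj⟩ : ∃ j, Nat.find hex = j + 1 := by
    refine Nat.exists_eq_succ_of_ne_zero fun h0 => ?_
    have h := Nat.find_spec hex
    rw [h0] at h
    simp [hitTimes] at h
  have h1 : hitTimes B j ≤ s := not_lt.1 (Nat.find_min hex (by omega))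
  exact ⟨j, h1, hj ▸ Nat.find_spec hex, nextTime_le_iff.2 ⟨t, le_rfl, s, hst, h1, hB⟩⟩

/-- The running maximum of `p` over pairs `a < b ≤ t`. -/
noncomputable def runningMax (p : ℕ → ℕ → ℝ≥0∞) (t : ℕ) : ℝ≥0∞ :=
  (Finset.range (t + 1)).sup fun b => (Finset.range b).sup fun a => p a b

theorem le_runningMax (p : ℕ → ℕ → ℝ≥0∞) {a b t : ℕ} (hab : a < b) (hbt : b ≤ t) :
    p a b ≤ runningMax p t :=
  (Finset.le_sup (f := fun a => p a b) (Finset.mem_range.2 hab)).trans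
    (Finset.le_sup (f := fun b => (Finset.range b).sup fun a => p a b)
      (Finset.mem_range.2 (Nat.lt_succ_of_le hbt)))

theorem runningMax_le {p : ℕ → ℕ → ℝ≥0∞} {Z : ℝ≥0∞} (h : ∀ a b, a < b → p a b ≤ Z) (t : ℕ) :
    runningMax p t ≤ Z :=
  Finset.sup_le fun _ _ => Finset.sup_le fun _ ha => h _ _ (Finset.mem_range.1 ha)

theorem runningMax_mono (p : ℕ → ℕ → ℝ≥0∞) : Monotone (runningMax p) := fun s t hst =>
  Finset.sup_mono (Finset.range_mono (by omega))

theorem runningMax_ne_top {p : ℕ → ℕ → ℝ≥0∞} (h : ∀ a b, p a b ≠ ∞) (t : ℕ) :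
    runningMax p t ≠ ∞ := by
  refine ne_of_lt ((Finset.sup_lt_iff (by simp)).2 fun b _ => ?_)
  exact (Finset.sup_lt_iff (by simp)).2 fun a _ => lt_top_iff_ne_top.2 (h a b)

/-- The pair `s, t` is large at level `m` relative to the running maximum at its endpoint. -/
def IsLargePair (p : ℕ → ℕ → ℝ≥0∞) (m s t : ℕ) : Prop :=
  dyadicWeight 1 (m + 1) * runningMax p t < p s t

/-- The supremum of `p` over pairs within the `j`-th interval of the partition `τ`. -/
noncomputable def intervalSup (p : ℕ → ℕ → ℝ≥0∞) (τ : ℕ → ℕ∞) (j : ℕ) : ℝ≥0∞ :=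
  ⨆ (t : ℕ) (t' : ℕ) (_ : τ j ≤ (t : ℕ∞)) (_ : t < t') (_ : (t' : ℕ∞) ≤ τ (j + 1)), p t t'

theorem le_intervalSup (p : ℕ → ℕ → ℝ≥0∞) {τ : ℕ → ℕ∞} {j t t' : ℕ} (h1 : τ j ≤ (t : ℕ∞))
    (h2 : t < t') (h3 : (t' : ℕ∞) ≤ τ (j + 1)) : p t t' ≤ intervalSup p τ j :=
  le_iSup₂_of_le t t' (le_iSup₂_of_le h1 h2 (le_iSup_of_le h3 le_rfl))

theorem sum_level_le {ρ : ℝ} (hρ : 0 < ρ) (p : ℕ → ℕ → ℝ≥0∞) (m : ℕ) {u : ℕ → ℕ}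
    (hu : Monotone u) (A : Finset ℕ)
    (hA : ∀ l ∈ A, u l < u (l + 1) ∧ IsLargePair p m (u l) (u (l + 1)) ∧
      p (u l) (u (l + 1)) ≤ dyadicWeight 1 m * runningMax p (u (l + 1)) ∧
      runningMax p (u (l + 1)) ^ ρ ≤ 2 * runningMax p (u l) ^ ρ) :
    ∑ l ∈ A, p (u l) (u (l + 1)) ^ ρ
      ≤ 2 * 2 ^ ρ * ∑' j, intervalSup p (hitTimes (IsLargePair p m)) j ^ ρ := by
  set τ := hitTimes (IsLargePair p m) with hτ
  have hex : ∀ l ∈ A, ∃ j, τ j ≤ u l ∧ (u l : ℕ∞) < τ (j + 1) ∧ τ (j + 1) ≤ u (l + 1) :=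
    fun l hl => exists_hitTimes_mem (hA l hl).1 (hA l hl).2.1
  choose! J hJ1 hJ2 hJ3 using hex
  have hlt : ∀ l ∈ A, ∀ l' ∈ A, l < l' → J l ≠ J l' := by
    intro l hl l' hl' hll he
    have h1 : (u (l + 1) : ℕ∞) ≤ u l' := by exact_mod_cast hu (Nat.succ_le_of_lt hll)
    have h2 := hJ1 l' hl'
    have h3 := hJ3 l hl
    have h4 := hJ2 l' hl'
    rw [← he] at h4
    exact absurd (h3.trans h1) (not_le.2 h4)
  have hinj : Set.InjOn J A := by
    intro l hl l' hl' he
    by_contra hne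
    rcases lt_or_gt_of_ne hne with h | h
    · exact hlt l hl l' hl' h he
    · exact hlt l' hl' l hl h he.symm
  have hterm : ∀ l ∈ A, p (u l) (u (l + 1)) ^ ρ ≤ 2 * 2 ^ ρ * intervalSup p τ (J l) ^ ρ := by
    intro l hl
    obtain ⟨-, -, hple, hdouble⟩ := hA l hl
    obtain ⟨n, hn⟩ : ∃ n : ℕ, τ (J l + 1) = n :=
      ⟨_, (ENat.natCast_toNat (ne_top_of_le_ne_top (ENat.natCast_ne_top _) (hJ3 l hl))).symm⟩
    obtain ⟨s, hsn, hs, hB⟩ := exists_of_nextTime_eq (B := IsLargePair p m) (x := τ (J l)) hn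
    have hun : u l ≤ n := by
      have := (hJ2 l hl).le
      rw [hn] at this
      exact_mod_cast this
    have hG : dyadicWeight 1 (m + 1) * runningMax p n ≤ intervalSup p τ (J l) :=
      hB.le.trans (le_intervalSup p hs hsn hn.ge)
    have hw : dyadicWeight 1 m = 2 * dyadicWeight 1 (m + 1) := by
      rw [dyadicWeight_succ, ← mul_assoc, ENNReal.rpow_neg_one,
        ENNReal.mul_inv_cancel (by simp) (by simp), one_mul]
    calc p (u l) (u (l + 1)) ^ ρ
        ≤ (dyadicWeight 1 m * runningMax p (u (l + 1))) ^ ρ := by gcongr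
      _ = dyadicWeight 1 m ^ ρ * runningMax p (u (l + 1)) ^ ρ :=
          ENNReal.mul_rpow_of_nonneg _ _ hρ.le
      _ ≤ dyadicWeight 1 m ^ ρ * (2 * runningMax p n ^ ρ) := by
          gcongr
          refine hdouble.trans ?_
          gcongr
          exact runningMax_mono p hun
      _ = 2 * 2 ^ ρ * (dyadicWeight 1 (m + 1) * runningMax p n) ^ ρ := by
          rw [hw, ENNReal.mul_rpow_of_nonneg _ _ hρ.le, ENNReal.mul_rpow_of_nonneg _ _ hρ.le]
          ring
      _ ≤ 2 * 2 ^ ρ * intervalSup p τ (J l) ^ ρ := by gcongr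
  calc ∑ l ∈ A, p (u l) (u (l + 1)) ^ ρ
      ≤ ∑ l ∈ A, 2 * 2 ^ ρ * intervalSup p τ (J l) ^ ρ := Finset.sum_le_sum hterm
    _ = 2 * 2 ^ ρ * ∑ j ∈ A.image J, intervalSup p τ j ^ ρ := by
        rw [← Finset.mul_sum, Finset.sum_image hinj]
    _ ≤ 2 * 2 ^ ρ * ∑' j, intervalSup p τ j ^ ρ := by
        gcongr
        exact ENNReal.sum_le_tsum _

open Classical in
theorem sum_doubling_le (f : ℕ → ℝ≥0∞) (hf : Monotone f) (n : ℕ) :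
    ∑ l ∈ Finset.range n with 2 * f l < f (l + 1), f (l + 1) ≤ 2 * f n := by
  induction n with
  | zero => simp
  | succ n ih =>
    rw [Finset.range_add_one, Finset.filter_insert]
    split_ifs with h
    · rw [Finset.sum_insert (by simp), two_mul (f (n + 1))]
      exact add_le_add le_rfl (ih.trans h.le)
    · exact ih.trans (mul_le_mul_right (hf n.le_succ) 2)

/-- The constant in the pointwise estimate of the variation. -/
noncomputable def variationConst (ρ δ : ℝ) : ℝ≥0∞ :=
  2 + 2 * 2 ^ ρ * 2 ^ (δ / 2) * ∑' m, dyadicWeight (δ / 2) m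

theorem variationConst_lt_top {ρ δ : ℝ} (hρ : 0 < ρ) (hδ : 0 < δ) : variationConst ρ δ < ∞ := by
  refine ENNReal.add_lt_top.2
    ⟨by simp, ENNReal.mul_lt_top ?_ (tsum_dyadicWeight_lt_top (by linarith))⟩
  refine ENNReal.mul_lt_top (ENNReal.mul_lt_top (by simp) ?_) ?_ <;>
  exact ENNReal.rpow_lt_top_of_nonneg (by linarith) (by simp)

theorem sum_rpow_le {ρ δ : ℝ} (hρ : 0 < ρ) (hδ : 0 < δ) {p : ℕ → ℕ → ℝ≥0∞}
    (hp0 : ∀ t, p t t = 0) (hpt : ∀ s t, p s t ≠ ∞) {Z : ℝ≥0∞}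
    (hZ : ∀ a b, a < b → p a b ≤ Z)
    (hS : ∀ m, dyadicWeight (δ / 2) (m + 1) *
      ∑' j, intervalSup p (hitTimes (IsLargePair p m)) j ^ ρ ≤ Z ^ ρ)
    {u : ℕ → ℕ} (hu : Monotone u) (L : ℕ) :
    ∑ l ∈ Finset.range L, p (u l) (u (l + 1)) ^ (ρ + δ) ≤ variationConst ρ δ * Z ^ (ρ + δ) := by
  classical
  set x : ℕ → ℝ≥0∞ := fun l => p (u l) (u (l + 1)) with hx
  set M : ℕ → ℝ≥0∞ := fun l => runningMax p (u l) with hM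
  set E := (Finset.range L).filter fun l => 2 * M l ^ ρ < M (l + 1) ^ ρ with hE
  let A : ℕ → Finset ℕ := fun m => (Finset.range L).filter fun l =>
    u l < u (l + 1) ∧ IsLargePair p m (u l) (u (l + 1)) ∧
      x l ≤ dyadicWeight 1 m * M (l + 1) ∧ M (l + 1) ^ ρ ≤ 2 * M l ^ ρ
  have hMZ : ∀ l, M l ≤ Z := fun l => runningMax_le hZ _
  have hxM : ∀ l, x l ≤ M (l + 1) := by
    intro l
    rcases (hu l.le_succ).eq_or_lt with h | h
    · simp only [hx]
      rw [← h, hp0]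
      exact zero_le
    · exact le_runningMax p h le_rfl
  have hsplit : ∀ l, x l ^ (ρ + δ) = x l ^ δ * x l ^ ρ := fun l => by
    rw [add_comm, ENNReal.rpow_add_of_nonneg _ _ hδ.le hρ.le]
  have hZsplit : Z ^ (ρ + δ) = Z ^ δ * Z ^ ρ := by
    rw [add_comm, ENNReal.rpow_add_of_nonneg _ _ hδ.le hρ.le]
  have hEsum : ∑ l ∈ E, x l ^ (ρ + δ) ≤ 2 * Z ^ (ρ + δ) := by
    calc ∑ l ∈ E, x l ^ (ρ + δ) ≤ ∑ l ∈ E, Z ^ δ * M (l + 1) ^ ρ := by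
          refine Finset.sum_le_sum fun l _ => ?_
          rw [hsplit]
          gcongr
          · exact (hxM l).trans (hMZ _)
          · exact hxM l
      _ ≤ Z ^ δ * (2 * M L ^ ρ) := by
          rw [← Finset.mul_sum]
          gcongr
          exact sum_doubling_le (fun l => M l ^ ρ)
            (fun a b hab => ENNReal.rpow_le_rpow (runningMax_mono p (hu hab)) hρ.le) L
      _ ≤ Z ^ δ * (2 * Z ^ ρ) := by
          gcongr
          exact hMZ L
      _ = 2 * Z ^ (ρ + δ) := by
          rw [hZsplit]
          ring
  have hAsum : ∀ m, ∑ l ∈ A m, x l ^ (ρ + δ)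
      ≤ 2 * 2 ^ ρ * 2 ^ (δ / 2) * Z ^ (ρ + δ) * dyadicWeight (δ / 2) m := by
    intro m
    set T := ∑' j, intervalSup p (hitTimes (IsLargePair p m)) j ^ ρ with hT
    have hw : dyadicWeight δ m
        = dyadicWeight (δ / 2) m * (2 ^ (δ / 2) * dyadicWeight (δ / 2) (m + 1)) := by
      rw [dyadicWeight_succ, ← mul_assoc (2 ^ (δ / 2)), ← ENNReal.rpow_add _ _ (by simp) (by simp),
        add_neg_cancel, ENNReal.rpow_zero, one_mul, dyadicWeight_mul, add_halves]
    calc ∑ l ∈ A m, x l ^ (ρ + δ)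
        ≤ ∑ l ∈ A m, dyadicWeight δ m * Z ^ δ * x l ^ ρ := by
          refine Finset.sum_le_sum fun l hl => ?_
          have hl' := (Finset.mem_filter.1 hl).2.2.2.1
          rw [hsplit]
          gcongr
          calc x l ^ δ ≤ (dyadicWeight 1 m * Z) ^ δ := by
                gcongr
                exact hl'.trans (mul_le_mul_right (hMZ _) _)
            _ = dyadicWeight δ m * Z ^ δ := by
                rw [ENNReal.mul_rpow_of_nonneg _ _ hδ.le, dyadicWeight_rpow, one_mul]
      _ = dyadicWeight δ m * Z ^ δ * ∑ l ∈ A m, x l ^ ρ := by rw [Finset.mul_sum]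
      _ ≤ dyadicWeight δ m * Z ^ δ * (2 * 2 ^ ρ * T) := by
          gcongr
          exact sum_level_le hρ p m hu (A m) fun l hl => (Finset.mem_filter.1 hl).2
      _ = dyadicWeight (δ / 2) m * Z ^ δ * 2 ^ (δ / 2) * (2 * 2 ^ ρ)
            * (dyadicWeight (δ / 2) (m + 1) * T) := by
          rw [hw]
          ring
      _ ≤ dyadicWeight (δ / 2) m * Z ^ δ * 2 ^ (δ / 2) * (2 * 2 ^ ρ) * Z ^ ρ := by
          gcongr
          exact hS m
      _ = 2 * 2 ^ ρ * 2 ^ (δ / 2) * Z ^ (ρ + δ) * dyadicWeight (δ / 2) m := by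
          rw [hZsplit]
          ring
  have hcover : ∀ l ∈ Finset.range L, x l ^ (ρ + δ)
      ≤ (if 2 * M l ^ ρ < M (l + 1) ^ ρ then x l ^ (ρ + δ) else 0)
        + ∑' m, if l ∈ A m then x l ^ (ρ + δ) else 0 := by
    intro l hl
    by_cases hlE : 2 * M l ^ ρ < M (l + 1) ^ ρ
    · rw [if_pos hlE]
      exact le_self_add
    by_cases hx0 : x l = 0
    · rw [hx0, ENNReal.zero_rpow_of_pos (by linarith)]
      exact zero_le
    obtain ⟨m, hm1, hm2⟩ := exists_dyadic_level hx0 (hxM l) (runningMax_ne_top hpt _)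
    have hlt : u l < u (l + 1) := by
      refine lt_of_le_of_ne (hu l.le_succ) fun h => hx0 ?_
      simp only [hx]
      rw [← h, hp0]
    have hlA : l ∈ A m := Finset.mem_filter.2 ⟨hl, hlt, hm1, hm2, not_lt.1 hlE⟩
    refine le_trans ?_ le_add_self
    refine le_trans ?_ (ENNReal.le_tsum m)
    rw [if_pos hlA]
  calc ∑ l ∈ Finset.range L, x l ^ (ρ + δ)
      ≤ ∑ l ∈ Finset.range L, ((if 2 * M l ^ ρ < M (l + 1) ^ ρ then x l ^ (ρ + δ) else 0)
        + ∑' m, if l ∈ A m then x l ^ (ρ + δ) else 0) := Finset.sum_le_sum hcover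
    _ = ∑ l ∈ E, x l ^ (ρ + δ) + ∑' m, ∑ l ∈ A m, x l ^ (ρ + δ) := by
        rw [Finset.sum_add_distrib, ← Finset.sum_filter,
          ← Summable.tsum_finsetSum fun _ _ => ENNReal.summable]
        congr 1
        refine tsum_congr fun m => ?_
        rw [← Finset.sum_filter]
        congr 1
        ext l
        simp [A]
    _ ≤ 2 * Z ^ (ρ + δ)
        + ∑' m, 2 * 2 ^ ρ * 2 ^ (δ / 2) * Z ^ (ρ + δ) * dyadicWeight (δ / 2) m :=
        add_le_add hEsum (ENNReal.tsum_le_tsum hAsum)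
    _ = variationConst ρ δ * Z ^ (ρ + δ) := by
        rw [ENNReal.tsum_mul_left, variationConst]
        ring

/-- The `ℓ^ρ` norm of the interval suprema of `p` along the partition `τ`. -/
noncomputable def stoppedNorm (ρ : ℝ) (p : ℕ → ℕ → ℝ≥0∞) (τ : ℕ → ℕ∞) : ℝ≥0∞ :=
  (∑' j, intervalSup p τ j ^ ρ) ^ (1 / ρ)

theorem stoppedNorm_rpow {ρ : ℝ} (hρ : 0 < ρ) (p : ℕ → ℕ → ℝ≥0∞) (τ : ℕ → ℕ∞) :
    stoppedNorm ρ p τ ^ ρ = ∑' j, intervalSup p τ j ^ ρ := by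
  rw [stoppedNorm, one_div, ENNReal.rpow_inv_rpow hρ.ne']

theorem intervalSup_le_stoppedNorm {ρ : ℝ} (hρ : 0 < ρ) (p : ℕ → ℕ → ℝ≥0∞) (τ : ℕ → ℕ∞)
    (j : ℕ) : intervalSup p τ j ≤ stoppedNorm ρ p τ := by
  rw [← ENNReal.rpow_le_rpow_iff hρ, stoppedNorm_rpow hρ]
  exact ENNReal.le_tsum j

/-- The partition `0, ∞, ∞, …` for `n = 0`, and the hitting times of large pairs at level
`n - 1` otherwise. -/
noncomputable def levelPartition (p : ℕ → ℕ → ℝ≥0∞) : ℕ → ℕ → ℕ∞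
  | 0, j => if j = 0 then 0 else ⊤
  | m + 1, j => hitTimes (IsLargePair p m) j

theorem VvarN_le {ρ r : ℝ} (hρ : 0 < ρ) (hρr : ρ < r) {P : ℕ → ℕ → ℝ} (hP : ∀ t, P t t = 0) :
    VvarN r P ≤ variationConst ρ (r - ρ) ^ (1 / r) *
      ⨆ n, dyadicWeight ((r - ρ) / (2 * ρ)) n *
        stoppedNorm ρ (fun s t => ENNReal.ofReal |P s t|)
          (levelPartition (fun s t => ENNReal.ofReal |P s t|) n) := by
  set p : ℕ → ℕ → ℝ≥0∞ := fun s t => ENNReal.ofReal |P s t| with hp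
  set δ := r - ρ with hδ
  have hδ0 : 0 < δ := sub_pos.2 hρr
  have hr : 0 < r := hρ.trans hρr
  have hrδ : r = ρ + δ := by
    rw [hδ]
    ring
  set Z := ⨆ n, dyadicWeight (δ / (2 * ρ)) n * stoppedNorm ρ p (levelPartition p n) with hZdef
  have hle : ∀ n, dyadicWeight (δ / (2 * ρ)) n * stoppedNorm ρ p (levelPartition p n) ≤ Z :=
    fun n => le_iSup (fun n => dyadicWeight (δ / (2 * ρ)) n
      * stoppedNorm ρ p (levelPartition p n)) n
  have hZ : ∀ a b, a < b → p a b ≤ Z := by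
    intro a b hab
    have h0 := hle 0
    rw [dyadicWeight_zero, one_mul] at h0
    refine le_trans ?_ ((intervalSup_le_stoppedNorm hρ p _ 0).trans h0)
    exact le_intervalSup p (by simp [levelPartition]) hab (by simp [levelPartition])
  have hS : ∀ m, dyadicWeight (δ / 2) (m + 1) *
      ∑' j, intervalSup p (hitTimes (IsLargePair p m)) j ^ ρ ≤ Z ^ ρ := by
    intro m
    have h := ENNReal.rpow_le_rpow (hle (m + 1)) hρ.le
    rw [ENNReal.mul_rpow_of_nonneg _ _ hρ.le, dyadicWeight_rpow, stoppedNorm_rpow hρ,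
      show δ / (2 * ρ) * ρ = δ / 2 by field_simp] at h
    exact h
  refine iSup_le fun L => iSup₂_le fun u hu => ?_
  rw [one_div, ENNReal.rpow_inv_le_iff hr, ENNReal.mul_rpow_of_nonneg _ _ hr.le,
    ENNReal.rpow_inv_rpow hr.ne']
  let v : ℕ → ℕ := fun n => u ⟨min n L, by omega⟩
  have hv : Monotone v := fun a b hab => hu (Fin.mk_le_mk.2 (by omega))
  have hmain := sum_rpow_le hρ hδ0 (p := p) (by simp [hp, hP]) (by simp [hp]) hZ hS hv L
  rw [← hrδ] at hmain
  refine le_trans (le_of_eq ?_) hmain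
  rw [Finset.sum_range]
  refine Finset.sum_congr rfl fun l _ => ?_
  have h1 : u l.castSucc = v l := congrArg u (Fin.ext (by simp [l.2.le]))
  have h2 : u l.succ = v (l + 1) :=
    congrArg u (Fin.ext (by simp only [Fin.val_succ]; omega))
  rw [h1, h2]

theorem lqNorm_mono {Ω : Type*} [MeasurableSpace Ω] {μ : Measure Ω} {q : ℝ≥0∞}
    {f g : Ω → ℝ≥0∞} (h : ∀ ω, f ω ≤ g ω) : lqNorm μ q f ≤ lqNorm μ q g := by
  unfold lqNorm
  split_ifs
  · exact essSup_mono_ae (Filter.Eventually.of_forall h)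
  · gcongr with ω
    exact h ω

/-- The constant in the `L^q` estimate of a dyadically weighted supremum. -/
noncomputable def supConst (q : ℝ≥0∞) (ε : ℝ) : ℝ≥0∞ :=
  if q = ∞ then 1 else (∑' n, dyadicWeight (ε * q.toReal) n) ^ (1 / q.toReal)

theorem supConst_lt_top {q : ℝ≥0∞} (hq : 0 < q) {ε : ℝ} (hε : 0 < ε) : supConst q ε < ∞ := by
  unfold supConst
  split_ifs with h
  · simp
  · have hq' : 0 < q.toReal := ENNReal.toReal_pos hq.ne' h
    exact ENNReal.rpow_lt_top_of_nonneg (by positivity)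
      (tsum_dyadicWeight_lt_top (by positivity)).ne

theorem lqNorm_mul_iSup_le {Ω : Type*} [MeasurableSpace Ω] {μ : Measure Ω} {q : ℝ≥0∞}
    (hq : 0 < q) {ε : ℝ} (hε : 0 < ε) {K : ℝ≥0∞} (hK : K ≠ ∞) {S : ℕ → Ω → ℝ≥0∞}
    (hS : ∀ n, Measurable (S n)) {A : ℝ≥0∞} (hA : ∀ n, lqNorm μ q (S n) ≤ A) :
    lqNorm μ q (fun ω => K * ⨆ n, dyadicWeight ε n * S n ω) ≤ K * supConst q ε * A := by
  by_cases hqt : q = ∞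
  · simp only [lqNorm, supConst, hqt, if_true, mul_one] at hA ⊢
    have hae : ∀ᵐ ω ∂μ, ∀ n, S n ω ≤ A :=
      ae_all_iff.2 fun n => (ENNReal.ae_le_essSup (S n)).mono fun ω h => h.trans (hA n)
    refine essSup_le_of_ae_le _ (hae.mono fun ω h => ?_)
    refine mul_le_mul_right (iSup_le fun n => ?_) K
    refine le_trans ?_ (h n)
    refine mul_le_of_le_one_left zero_le ?_
    rw [dyadicWeight_eq_pow]
    exact pow_le_one₀ zero_le (two_rpow_neg_lt_one hε).le
  · have hq' : 0 < q.toReal := ENNReal.toReal_pos hq.ne' hqt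
    simp only [lqNorm, supConst, hqt, if_false] at hA ⊢
    have hA' : ∀ n, ∫⁻ ω, S n ω ^ q.toReal ∂μ ≤ A ^ q.toReal := fun n => by
      have h := hA n
      rwa [one_div, ENNReal.rpow_inv_le_iff hq'] at h
    rw [one_div, ENNReal.rpow_inv_le_iff hq', ENNReal.mul_rpow_of_nonneg _ _ hq'.le,
      ENNReal.mul_rpow_of_nonneg _ _ hq'.le, ENNReal.rpow_inv_rpow hq'.ne']
    have hpt : ∀ ω, (K * ⨆ n, dyadicWeight ε n * S n ω) ^ q.toReal
        ≤ K ^ q.toReal * ∑' n, dyadicWeight (ε * q.toReal) n * S n ω ^ q.toReal := by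
      intro ω
      rw [ENNReal.mul_rpow_of_nonneg _ _ hq'.le]
      gcongr
      rw [← ENNReal.le_rpow_inv_iff hq']
      refine iSup_le fun n => ?_
      rw [ENNReal.le_rpow_inv_iff hq', ENNReal.mul_rpow_of_nonneg _ _ hq'.le, dyadicWeight_rpow]
      exact ENNReal.le_tsum (f := fun n => dyadicWeight (ε * q.toReal) n * S n ω ^ q.toReal) n
    calc ∫⁻ ω, (K * ⨆ n, dyadicWeight ε n * S n ω) ^ q.toReal ∂μ
        ≤ ∫⁻ ω, K ^ q.toReal * ∑' n, dyadicWeight (ε * q.toReal) n * S n ω ^ q.toReal ∂μ :=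
          lintegral_mono hpt
      _ = K ^ q.toReal * ∑' n, dyadicWeight (ε * q.toReal) n * ∫⁻ ω, S n ω ^ q.toReal ∂μ := by
          rw [lintegral_const_mul' _ _ (ENNReal.rpow_ne_top_of_nonneg hq'.le hK), lintegral_tsum]
          · congr 1
            exact tsum_congr fun n => lintegral_const_mul _ ((hS n).pow_const _)
          · exact fun n => (((hS n).pow_const _).const_mul _).aemeasurable
      _ ≤ K ^ q.toReal * ∑' n, dyadicWeight (ε * q.toReal) n * A ^ q.toReal := by
          gcongr with n
          exact hA' n
      _ = K ^ q.toReal * (∑' n, dyadicWeight (ε * q.toReal) n) * A ^ q.toReal := by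
          rw [ENNReal.tsum_mul_right, mul_assoc]

theorem measurable_stoppedNorm {Ω : Type*} {mΩ : MeasurableSpace Ω} (ρ : ℝ)
    {p : Ω → ℕ → ℕ → ℝ≥0∞} (hp : ∀ s t, s ≤ t → Measurable fun ω => p ω s t)
    {τ : Ω → ℕ → ℕ∞} (hτ : ∀ j n : ℕ, MeasurableSet {ω | τ ω j ≤ n}) :
    Measurable fun ω => stoppedNorm ρ (p ω) (τ ω) := by
  refine Measurable.pow_const (Measurable.tsum fun j => Measurable.pow_const ?_ _) _
  refine Measurable.iSup fun t => Measurable.iSup fun t' => ?_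
  by_cases htt : t < t'
  · obtain ⟨k, rfl⟩ : ∃ k, t' = k + 1 := ⟨t' - 1, by omega⟩
    have hset : MeasurableSet ({ω | τ ω j ≤ t} ∩ {ω | τ ω (j + 1) ≤ k}ᶜ) :=
      (hτ j t).inter (hτ (j + 1) k).compl
    convert (hp t (k + 1) htt.le).indicator hset using 1
    ext ω
    have hiff : ((k + 1 : ℕ) : ℕ∞) ≤ τ ω (j + 1) ↔ ¬ τ ω (j + 1) ≤ k := by
      rw [not_le, Nat.cast_add, Nat.cast_one, ENat.add_one_le_iff (ENat.natCast_ne_top k)]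
    by_cases h1 : τ ω j ≤ t <;> by_cases h2 : τ ω (j + 1) ≤ k <;>
      simp only [Set.indicator, Set.mem_inter_iff, Set.mem_ofPred_eq, Set.mem_compl_iff, hiff, h1,
        h2, htt, not_true_eq_false, not_false_eq_true, and_true, and_false, iSup_true,
        iSup_false, if_true, if_false, bot_eq_zero]
  · simp [htt]

theorem measurable_runningMax {Ω : Type*} {mΩ : MeasurableSpace Ω} {p : Ω → ℕ → ℕ → ℝ≥0∞}
    (t : ℕ) (hp : ∀ a b, a < b → b ≤ t → Measurable fun ω => p ω a b) :
    Measurable fun ω => runningMax (p ω) t := by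
  have key : ∀ (s : Finset ℕ) (f : ℕ → Ω → ℝ≥0∞), (∀ i ∈ s, Measurable (f i)) →
      Measurable fun ω => s.sup fun i => f i ω := by
    intro s f hf
    classical
    induction s using Finset.induction_on with
    | empty => simp
    | insert i s _ ih =>
      simp_rw [Finset.sup_insert]
      exact (hf i (Finset.mem_insert_self i s)).sup
        (ih fun k hk => hf k (Finset.mem_insert_of_mem hk))
  refine key _ _ fun b hb => key _ _ fun a ha => ?_
  exact hp a b (Finset.mem_range.1 ha) (Nat.le_of_lt_succ (Finset.mem_range.1 hb))

theorem measurableSet_levelPartition_le {Ω : Type*} {mΩ : MeasurableSpace Ω}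
    {ℱ : Filtration ℕ mΩ} {p : Ω → ℕ → ℕ → ℝ≥0∞}
    (hp : ∀ s t, s ≤ t → Measurable[ℱ t] fun ω => p ω s t) (m j n : ℕ) :
    MeasurableSet[ℱ n] {ω | levelPartition (p ω) m j ≤ (n : ℕ∞)} := by
  cases m with
  | zero => exact @MeasurableSet.const Ω (ℱ n) ((if j = 0 then 0 else ⊤ : ℕ∞) ≤ n)
  | succ m =>
    simp only [levelPartition]
    induction j generalizing n with
    | zero => exact @MeasurableSet.const Ω (ℱ n) ((0 : ℕ∞) ≤ n)
    | succ j ih =>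
      have hset : {ω | hitTimes (IsLargePair (p ω) m) (j + 1) ≤ (n : ℕ∞)}
          = ⋃ t ∈ Set.Iic n, ⋃ s ∈ Set.Iio t, {ω | hitTimes (IsLargePair (p ω) m) j ≤ (s : ℕ∞)}
            ∩ {ω | dyadicWeight 1 (m + 1) * runningMax (p ω) t < p ω s t} := by
        ext ω
        simp only [Set.mem_ofPred_eq, hitTimes, nextTime_le_iff, Set.mem_iUnion, Set.mem_Iic,
          Set.mem_Iio, Set.mem_inter_iff, exists_prop, IsLargePair]
      rw [hset]
      refine MeasurableSet.biUnion (Set.to_countable _) fun t (ht : t ≤ n) =>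
        MeasurableSet.biUnion (Set.to_countable _) fun s (hs : s < t) => ?_
      refine MeasurableSet.inter (ℱ.mono (hs.le.trans ht) _ (ih s)) ?_
      refine ℱ.mono ht _ (measurableSet_lt ?_ (hp s t hs.le))
      refine Measurable.const_mul ?_ _
      exact measurable_runningMax (mΩ := ℱ t) t fun a b hab hbt =>
        (hp a b hab.le).mono (ℱ.mono hbt) le_rfl

theorem levelPartition_zero_right (p : ℕ → ℕ → ℝ≥0∞) (m : ℕ) : levelPartition p m 0 = 0 := by
  cases m <;> simp [levelPartition, hitTimes]

theorem levelPartition_le_succ (p : ℕ → ℕ → ℝ≥0∞) (m j : ℕ) :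
    levelPartition p m j ≤ levelPartition p m (j + 1) := by
  cases m with
  | zero => simp [levelPartition]
  | succ m => exact hitTimes_le_succ _ j

theorem iSup_levelPartition (p : ℕ → ℕ → ℝ≥0∞) (m : ℕ) : ⨆ j, levelPartition p m j = ⊤ := by
  cases m with
  | zero => exact top_le_iff.1 (le_iSup_of_le 1 (by simp [levelPartition]))
  | succ m => exact iSup_hitTimes _

/-- the `L^q` norm of `V^r Π` of an adapted process vanishing on the
diagonal is bounded, up to a constant depending on `ρ, r, q`, by the supremum over
adapted partitions `τ` of the `L^q` norm of
`(Σ_j (sup_{τ_{j-1} ≤ t < t' ≤ τ_j} |Π_{t,t'}|)^ρ)^{1/ρ}`. -/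
theorem variation_via_stopped_suprema (ρ r : ℝ) (q : ℝ≥0∞)
    (hρ : 0 < ρ) (hρr : ρ < r) (hq : 0 < q) :
    ∃ C : ℝ≥0∞, C < ∞ ∧
      ∀ (Ω : Type) (mΩ : MeasurableSpace Ω) (μ : Measure Ω), IsProbabilityMeasure μ →
      ∀ (ℱ : Filtration ℕ mΩ) (P : ℕ → ℕ → Ω → ℝ),
        (∀ s t : ℕ, s ≤ t → StronglyMeasurable[ℱ t] (P s t)) →
        (∀ t ω, P t t ω = 0) →
        lqNorm μ q (fun ω => VvarN r fun s t => P s t ω)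
          ≤ C * ⨆ (τ : ℕ → Ω → ℕ∞)
              (_ : ∀ ω, τ 0 ω = 0)
              (_ : ∀ j ω, τ j ω ≤ τ (j + 1) ω)
              (_ : ∀ ω, (⨆ j, τ j ω) = ⊤)
              (_ : ∀ (j n : ℕ), MeasurableSet[ℱ n] {ω | τ j ω ≤ (n : ℕ∞)}),
              lqNorm μ q (fun ω =>
                (∑' j : ℕ,
                    (⨆ (t : ℕ) (t' : ℕ) (_ : τ j ω ≤ (t : ℕ∞)) (_ : t < t')
                        (_ : (t' : ℕ∞) ≤ τ (j + 1) ω),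
                      ENNReal.ofReal |P t t' ω|) ^ ρ) ^ (1 / ρ)) := by
  have hδ : 0 < r - ρ := sub_pos.2 hρr
  have hr : 0 < r := hρ.trans hρr
  have hε : 0 < (r - ρ) / (2 * ρ) := by positivity
  have hK : variationConst ρ (r - ρ) ^ (1 / r) < ∞ :=
    ENNReal.rpow_lt_top_of_nonneg (by positivity) (variationConst_lt_top hρ hδ).ne
  refine ⟨variationConst ρ (r - ρ) ^ (1 / r) * supConst q ((r - ρ) / (2 * ρ)),
    ENNReal.mul_lt_top hK (supConst_lt_top hq hε), ?_⟩
  intro Ω mΩ μ _ ℱ P hP hP0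
  set p : Ω → ℕ → ℕ → ℝ≥0∞ := fun ω s t => ENNReal.ofReal |P s t ω| with hp
  have hpm : ∀ s t, s ≤ t → Measurable[ℱ t] fun ω => p ω s t := by
    intro s t hst
    have h : Measurable[ℱ t] (P s t) := (hP s t hst).measurable
    exact ENNReal.measurable_ofReal.comp (continuous_abs.measurable.comp h)
  have hτ := measurableSet_levelPartition_le hpm
  refine (lqNorm_mono fun ω => VvarN_le hρ hρr fun t => hP0 t ω).trans ?_
  refine lqNorm_mul_iSup_le hq hε hK.ne
    (S := fun n ω => stoppedNorm ρ (p ω) (levelPartition (p ω) n)) (fun n => ?_) fun n => ?_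
  · exact measurable_stoppedNorm ρ (fun s t hst => (hpm s t hst).mono (ℱ.le t) le_rfl)
      fun j k => ℱ.le k _ (hτ n j k)
  · exact le_iSup_of_le (fun j ω => levelPartition (p ω) n j)
      (le_iSup_of_le (fun ω => levelPartition_zero_right _ _)
        (le_iSup_of_le (fun j ω => levelPartition_le_succ _ _ _)
          (le_iSup_of_le (fun ω => iSup_levelPartition _ _)
            (le_iSup_of_le (fun j k => hτ n j k) le_rfl))))
end

section
/- Vector-valued Burkholder–Davis–Gundy inequality at exponent one: let 1 ≤ q < ∞ and 1 ≤ r < ∞, and let (h^{(k)}_n)_n be a family of real-valued martingales with respect to a common filtration, indexed by k. Then ‖ (Σ_k (sup_n |h^{(k)}_n|)^r)^{1/r} ‖_{L^q} ≤ C(q,r) ‖ (Σ_k (Σ_n |dh^{(k)}_n|²)^{r/2} )^{1/r} ‖_{L^q}, i.e. the L^q(ℓ^r) norm of the maximal functions is controlled by the L^q(ℓ^r) norm of the square functions, including the endpoint q = 1. -/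
open MeasureTheory ENNReal

/-! ### Finite `ℓ^r` norms, running maxima and square functions -/

section Deterministic

variable {ι : Type} [Fintype ι]

/-- The `ℓ^r` norm of a finite family of reals. -/
noncomputable def lrNorm (r : ℝ) (a : ι → ℝ) : ℝ := (∑ k, |a k| ^ r) ^ (1 / r)

/-- The running maximum of the absolute values of the partial sums of `x`. -/
noncomputable def maxFn (x : ℕ → ℝ) (N : ℕ) : ℝ :=
  partialSups (fun n => |∑ m ∈ Finset.range n, x m|) N

/-- The square function of the first `N` differences. -/
noncomputable def sqFn (x : ℕ → ℝ) (N : ℕ) : ℝ := √(∑ m ∈ Finset.range N, x m ^ 2)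

lemma lrNorm_nonneg (r : ℝ) (a : ι → ℝ) : 0 ≤ lrNorm r a := by
  unfold lrNorm; positivity

lemma lrNorm_mono {r : ℝ} (hr : 1 ≤ r) {a b : ι → ℝ} (h : ∀ k, |a k| ≤ |b k|) :
    lrNorm r a ≤ lrNorm r b := by
  unfold lrNorm
  refine Real.rpow_le_rpow (by positivity) (Finset.sum_le_sum fun k _ => ?_) (by positivity)
  exact Real.rpow_le_rpow (abs_nonneg _) (h k) (by positivity)

lemma lrNorm_le_of_le {r : ℝ} (hr : 1 ≤ r) {a b : ι → ℝ} (h : ∀ k, |a k| ≤ b k) :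
    lrNorm r a ≤ lrNorm r b :=
  lrNorm_mono hr fun k => (h k).trans (le_abs_self _)

lemma lrNorm_add_le {r : ℝ} (hr : 1 ≤ r) (a b : ι → ℝ) :
    lrNorm r (fun k => a k + b k) ≤ lrNorm r a + lrNorm r b :=
  Real.Lp_add_le _ _ _ hr

lemma lrNorm_zero {r : ℝ} (hr : 1 ≤ r) : lrNorm r (fun _ : ι => (0 : ℝ)) = 0 := by
  have : r ≠ 0 := by positivity
  simp [lrNorm, Real.zero_rpow this, Real.zero_rpow (inv_ne_zero this)]

lemma lrNorm_smul {r : ℝ} (hr : 1 ≤ r) {c : ℝ} (hc : 0 ≤ c) (a : ι → ℝ) :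
    lrNorm r (fun k => c * a k) = c * lrNorm r a := by
  have : r ≠ 0 := by positivity
  unfold lrNorm
  simp_rw [abs_mul, Real.mul_rpow (abs_nonneg _) (abs_nonneg _), ← Finset.mul_sum]
  rw [Real.mul_rpow (by positivity) (by positivity), ← Real.rpow_mul (abs_nonneg _),
    mul_one_div_cancel this, Real.rpow_one, abs_of_nonneg hc]

lemma lrNorm_abs (r : ℝ) (a : ι → ℝ) : lrNorm r (fun k => |a k|) = lrNorm r a := by
  simp [lrNorm]

lemma lrNorm_sub_le {r : ℝ} (hr : 1 ≤ r) (a b : ι → ℝ) :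
    lrNorm r (fun k => a k - b k) ≤ lrNorm r a + lrNorm r b := by
  refine (lrNorm_mono hr (b := fun k => |a k| + |b k|) fun k => ?_).trans
    ((lrNorm_add_le hr _ _).trans_eq (by rw [lrNorm_abs, lrNorm_abs]))
  rw [abs_of_nonneg (by positivity : 0 ≤ |a k| + |b k|)]
  exact abs_sub _ _

lemma lrNorm_sum_le {r : ℝ} (hr : 1 ≤ r) (a : ℕ → ι → ℝ) (N : ℕ) :
    lrNorm r (fun k => ∑ n ∈ Finset.range N, a n k) ≤ ∑ n ∈ Finset.range N, lrNorm r (a n) := by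
  induction N with
  | zero => simp [lrNorm_zero hr]
  | succ N ih =>
    simp only [Finset.sum_range_succ]
    exact (lrNorm_add_le hr _ _).trans (by gcongr)

lemma lrNorm_rpow {r : ℝ} (hr : 1 ≤ r) (a : ι → ℝ) : lrNorm r a ^ r = ∑ k, |a k| ^ r := by
  have : r ≠ 0 := by positivity
  unfold lrNorm
  rw [← Real.rpow_mul (by positivity), one_div_mul_cancel this, Real.rpow_one]

lemma convexOn_lrNorm {r : ℝ} (hr : 1 ≤ r) :
    ConvexOn ℝ Set.univ (fun a : ι → ℝ => lrNorm r a) := by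
  refine ⟨convex_univ, fun a _ b _ s t hs ht _ => ?_⟩
  refine (lrNorm_add_le hr (fun k => s * a k) (fun k => t * b k)).trans_eq ?_
  rw [lrNorm_smul hr hs, lrNorm_smul hr ht, smul_eq_mul, smul_eq_mul]

lemma continuous_lrNorm {r : ℝ} (hr : 1 ≤ r) : Continuous (fun a : ι → ℝ => lrNorm r a) := by
  have : 0 < r := by positivity
  unfold lrNorm
  refine Continuous.rpow_const ?_ fun _ => Or.inr (by positivity)
  exact continuous_finsetSum _ fun k _ =>
    (continuous_abs.comp (continuous_apply k)).rpow_const fun _ => Or.inr this.le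

lemma lrNorm_le_sum {r : ℝ} (hr : 1 ≤ r) [DecidableEq ι] (a : ι → ℝ) :
    lrNorm r a ≤ ∑ k, |a k| := by
  have h0 : 0 < r := by positivity
  refine le_of_le_of_eq (b := (((∑ k, |a k|) ^ r) ^ (1 / r))) ?_ ?_
  · unfold lrNorm
    refine Real.rpow_le_rpow (by positivity) ?_ (by positivity)
    have : ∀ s : Finset ι, ∑ k ∈ s, |a k| ^ r ≤ (∑ k ∈ s, |a k|) ^ r := by
      intro s
      induction s using Finset.induction_on with
      | empty => simp [Real.zero_rpow h0.ne']
      | insert k s hk ih =>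
        rw [Finset.sum_insert hk, Finset.sum_insert hk]
        refine (add_le_add_right ih _).trans ?_
        exact Real.add_rpow_le_rpow_add (abs_nonneg _) (by positivity) hr
    exact this _
  · rw [← Real.rpow_mul (by positivity), mul_one_div_cancel h0.ne', Real.rpow_one]

lemma abs_sum_le_maxFn (x : ℕ → ℝ) {n N : ℕ} (h : n ≤ N) :
    |∑ m ∈ Finset.range n, x m| ≤ maxFn x N :=
  le_partialSups_of_le (fun n => |∑ m ∈ Finset.range n, x m|) h

lemma maxFn_le {x : ℕ → ℝ} {N : ℕ} {c : ℝ}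
    (h : ∀ n ≤ N, |∑ m ∈ Finset.range n, x m| ≤ c) : maxFn x N ≤ c :=
  partialSups_le _ _ _ h

lemma maxFn_zero (x : ℕ → ℝ) : maxFn x 0 = 0 := by simp [maxFn]

lemma maxFn_succ (x : ℕ → ℝ) (N : ℕ) :
    maxFn x (N + 1) = max (maxFn x N) |∑ m ∈ Finset.range (N + 1), x m| :=
  partialSups_succ _ _

lemma maxFn_nonneg (x : ℕ → ℝ) (N : ℕ) : 0 ≤ maxFn x N :=
  (abs_nonneg _).trans (abs_sum_le_maxFn x (Nat.zero_le N))

lemma maxFn_mono (x : ℕ → ℝ) : Monotone (maxFn x) := partialSups_monotone _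

lemma maxFn_congr {x y : ℕ → ℝ} {N : ℕ} (h : ∀ n < N, x n = y n) : maxFn x N = maxFn y N := by
  refine le_antisymm (maxFn_le fun n hn => ?_) (maxFn_le fun n hn => ?_)
  · rw [Finset.sum_congr rfl fun m hm => h m ((Finset.mem_range.1 hm).trans_le hn)]
    exact abs_sum_le_maxFn y hn
  · rw [← Finset.sum_congr rfl fun m hm => h m ((Finset.mem_range.1 hm).trans_le hn)]
    exact abs_sum_le_maxFn x hn

lemma maxFn_le_sum_abs (x : ℕ → ℝ) (N : ℕ) : maxFn x N ≤ ∑ n ∈ Finset.range N, |x n| :=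
  maxFn_le fun _ hn => (Finset.abs_sum_le_sum_abs _ _).trans
    (Finset.sum_le_sum_of_subset_of_nonneg (Finset.range_mono hn) fun _ _ _ => abs_nonneg _)

lemma maxFn_add_le (x y : ℕ → ℝ) (N : ℕ) :
    maxFn (fun n => x n + y n) N ≤ maxFn x N + maxFn y N :=
  maxFn_le fun n hn => by
    rw [Finset.sum_add_distrib]
    exact (abs_add_le _ _).trans (add_le_add (abs_sum_le_maxFn x hn) (abs_sum_le_maxFn y hn))

lemma sqFn_nonneg (x : ℕ → ℝ) (N : ℕ) : 0 ≤ sqFn x N := Real.sqrt_nonneg _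

lemma sqFn_zero (x : ℕ → ℝ) : sqFn x 0 = 0 := by simp [sqFn]

lemma sqFn_mono (x : ℕ → ℝ) : Monotone (sqFn x) := fun _ _ h =>
  Real.sqrt_le_sqrt (Finset.sum_le_sum_of_subset_of_nonneg (Finset.range_mono h)
    fun _ _ _ => sq_nonneg _)

lemma sqFn_mono_left {x y : ℕ → ℝ} {N : ℕ} (h : ∀ n < N, |x n| ≤ |y n|) :
    sqFn x N ≤ sqFn y N :=
  Real.sqrt_le_sqrt (Finset.sum_le_sum fun n hn => sq_le_sq.2 (h n (Finset.mem_range.1 hn)))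

lemma sqFn_congr {x y : ℕ → ℝ} {N : ℕ} (h : ∀ n < N, x n = y n) : sqFn x N = sqFn y N := by
  unfold sqFn
  rw [Finset.sum_congr rfl fun n hn => by rw [h n (Finset.mem_range.1 hn)]]

lemma abs_le_sqFn (x : ℕ → ℝ) {n N : ℕ} (h : n < N) : |x n| ≤ sqFn x N := by
  rw [← Real.sqrt_sq_eq_abs]
  exact Real.sqrt_le_sqrt (Finset.single_le_sum (f := fun n => x n ^ 2)
    (fun _ _ => sq_nonneg _) (Finset.mem_range.2 h))

lemma sqFn_succ_le (x : ℕ → ℝ) (N : ℕ) : sqFn x (N + 1) ≤ sqFn x N + |x N| := by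
  have h0 : 0 ≤ ∑ m ∈ Finset.range N, x m ^ 2 := Finset.sum_nonneg fun _ _ => sq_nonneg _
  unfold sqFn
  rw [Finset.sum_range_succ, ← Real.sqrt_sq_eq_abs]
  refine Real.sqrt_le_iff.2 ⟨by positivity, ?_⟩
  nlinarith [Real.sq_sqrt h0, Real.sq_sqrt (sq_nonneg (x N)),
    mul_nonneg (Real.sqrt_nonneg (∑ m ∈ Finset.range N, x m ^ 2)) (Real.sqrt_nonneg (x N ^ 2))]

lemma sqFn_succ_of_eq_zero {x : ℕ → ℝ} {N : ℕ} (h : x N = 0) : sqFn x (N + 1) = sqFn x N := by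
  simp [sqFn, Finset.sum_range_succ, h]

lemma sqFn_add_le (x y : ℕ → ℝ) (N : ℕ) :
    sqFn (fun n => x n + y n) N ≤ sqFn x N + ∑ n ∈ Finset.range N, |y n| := by
  have h := Real.Lp_add_le (Finset.range N) x y (p := 2) (by norm_num)
  simp only [← Real.sqrt_eq_rpow, Real.rpow_two, sq_abs] at h
  refine h.trans (add_le_add_right ?_ _)
  change sqFn y N ≤ _
  induction N with
  | zero => simp [sqFn]
  | succ N ih =>
    rw [Finset.sum_range_succ]
    have h' := Real.Lp_add_le (Finset.range N) x y (p := 2) (by norm_num)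
    simp only [← Real.sqrt_eq_rpow, Real.rpow_two, sq_abs] at h'
    exact (sqFn_succ_le y N).trans (add_le_add_left (ih h') _)

lemma maxFn_le_mul_sqFn (x : ℕ → ℝ) (N : ℕ) : maxFn x N ≤ N * sqFn x N := by
  refine (maxFn_le_sum_abs x N).trans ((Finset.sum_le_card_nsmul _ _ (sqFn x N)
    fun _ hn => abs_le_sqFn x (Finset.mem_range.1 hn)).trans_eq ?_)
  simp

/-- Pathwise form of Doob's `L²` inequality: the maximal function squared is dominated by
the square function squared plus a predictable transform. -/
lemma maxFn_sq_le (x : ℕ → ℝ) (N : ℕ) :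
    maxFn x N ^ 2 ≤ 4 * sqFn x N ^ 2 + ∑ n ∈ Finset.range N,
      (8 * (∑ m ∈ Finset.range n, x m)
        - 4 * (maxFn x n * SignType.sign (∑ m ∈ Finset.range n, x m))) * x n := by
  set h : ℕ → ℝ := fun n => ∑ m ∈ Finset.range n, x m with hh
  have hs : ∀ n, h (n + 1) = h n + x n := fun n => Finset.sum_range_succ _ _
  have hq : ∀ n, sqFn x n ^ 2 = ∑ m ∈ Finset.range n, x m ^ 2 := fun n =>
    Real.sq_sqrt (Finset.sum_nonneg fun _ _ => sq_nonneg _)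
  have key : ∀ n, maxFn x n ^ 2 ≤ 2 * maxFn x n * |h n|
      - 2 * ∑ m ∈ Finset.range n, maxFn x m * SignType.sign (h m) * x m := by
    intro n
    induction n with
    | zero => simp [maxFn_zero]
    | succ n ih =>
      rw [Finset.sum_range_succ]
      have h1 : |h n| + SignType.sign (h n) * x n ≤ |h (n + 1)| := by
        rw [hs]
        rcases lt_trichotomy (h n) 0 with h0 | h0 | h0
        · simp only [h0, sign_neg, abs_of_neg, SignType.coe_neg_one]
          have := neg_le_abs (h n + x n)
          linarith
        · simp [h0]
        · simp only [h0, sign_pos, abs_of_pos, SignType.coe_one]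
          have := le_abs_self (h n + x n)
          linarith
      have h2 := mul_le_mul_of_nonneg_left h1 (maxFn_nonneg x n)
      rcases max_cases (maxFn x n) |h (n + 1)| with ⟨e, e'⟩ | ⟨e, e'⟩
      · rw [maxFn_succ, e]; nlinarith
      · rw [maxFn_succ, e]; nlinarith
  have sq : ∀ n, h n ^ 2 = sqFn x n ^ 2 + 2 * ∑ m ∈ Finset.range n, h m * x m := by
    intro n
    induction n with
    | zero => simp [hh, sqFn]
    | succ n ih =>
      rw [hq, Finset.sum_range_succ, Finset.sum_range_succ, ← hq, hs]; linarith
  have e : ∑ n ∈ Finset.range N, (8 * h n - 4 * (maxFn x n * SignType.sign (h n))) * x n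
      = 8 * (∑ n ∈ Finset.range N, h n * x n)
        - 4 * ∑ n ∈ Finset.range N, maxFn x n * SignType.sign (h n) * x n := by
    rw [Finset.mul_sum, Finset.mul_sum, ← Finset.sum_sub_distrib]
    exact Finset.sum_congr rfl fun _ _ => by ring
  rw [e]
  have h3 := key N
  have h4 := sq N
  rw [← sq_abs] at h4
  nlinarith [sq_nonneg (maxFn x N - 2 * |h N|)]

end Deterministic

/-! ### Integration of tail estimates -/

section Tails

variable {Ω : Type} [MeasurableSpace Ω]

lemma lintegral_Ioi_indicator_rpow_le {p z : ℝ} (hp : 1 < p) (hz : 0 ≤ z) :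
    ∫⁻ t in Set.Ioi (0 : ℝ), (Set.Ioi z).indicator (fun t => ENNReal.ofReal (z ^ p * t ^ (-p))) t
      ≤ ENNReal.ofReal (1 / (p - 1)) * ENNReal.ofReal z := by
  rcases hz.eq_or_lt with rfl | hz
  · simp [Real.zero_rpow (by positivity : p ≠ 0)]
  have hint : IntegrableOn (fun t : ℝ => z ^ p * t ^ (-p)) (Set.Ioi z) :=
    (integrableOn_Ioi_rpow_of_lt (by linarith) hz).const_mul _
  calc _ ≤ ∫⁻ t, (Set.Ioi z).indicator (fun t => ENNReal.ofReal (z ^ p * t ^ (-p))) t :=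
        setLIntegral_le_lintegral _ _
    _ = ∫⁻ t in Set.Ioi z, ENNReal.ofReal (z ^ p * t ^ (-p)) :=
        lintegral_indicator measurableSet_Ioi _
    _ = ENNReal.ofReal (∫ t in Set.Ioi z, z ^ p * t ^ (-p)) := by
        rw [ofReal_integral_eq_lintegral_ofReal hint]
        refine (ae_restrict_iff' measurableSet_Ioi).2 (Filter.Eventually.of_forall fun t ht => ?_)
        have : 0 < t := hz.trans ht
        simp only [Pi.zero_apply]
        positivity
    _ ≤ _ := by
        rw [← ENNReal.ofReal_mul (by rw [one_div]; exact inv_nonneg.2 (by linarith))]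
        refine ENNReal.ofReal_le_ofReal (le_of_eq ?_)
        rw [integral_const_mul, integral_Ioi_rpow_of_lt (by linarith) hz]
        have h1 : z ^ p * z ^ (-p + 1) = z := by
          rw [← Real.rpow_add hz]; simp
        have h2 : -p + 1 ≠ 0 := by linarith
        have h3 : p - 1 ≠ 0 := by linarith
        rw [show z ^ p * (-z ^ (-p + 1) / (-p + 1)) = -(z ^ p * z ^ (-p + 1)) / (-p + 1) by ring, h1]
        field_simp
        ring

lemma lintegral_le_of_forall_meas_lt_le (μ : Measure Ω) [SFinite μ] {X Z : Ω → ℝ}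
    (hX : Measurable X) (hX0 : ∀ ω, 0 ≤ X ω) (hZ : Measurable Z) (hZ0 : ∀ ω, 0 ≤ Z ω)
    {p : ℝ} (hp : 1 < p) {C : ℝ≥0∞}
    (h : ∀ t : ℝ, 0 < t → μ {ω | t < X ω} ≤ μ {ω | t < Z ω}
      + C * (ENNReal.ofReal (t ^ (-p)) * ∫⁻ ω, ENNReal.ofReal (min t (Z ω) ^ p) ∂μ)) :
    ∫⁻ ω, ENNReal.ofReal (X ω) ∂μ
      ≤ (1 + C * (1 + ENNReal.ofReal (1 / (p - 1)))) * ∫⁻ ω, ENNReal.ofReal (Z ω) ∂μ := by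
  set k : ℝ → Ω → ℝ≥0∞ := fun t ω =>
    (Set.Ioi (Z ω)).indicator (fun t => ENNReal.ofReal (Z ω ^ p * t ^ (-p))) t with hk
  have hkm : Measurable (Function.uncurry k) := by
    have : Function.uncurry k = {y : ℝ × Ω | Z y.2 < y.1}.indicator
        (fun y => ENNReal.ofReal (Z y.2 ^ p * y.1 ^ (-p))) := by
      ext ⟨t, ω⟩
      simp [hk, Set.indicator_apply]
    rw [this]
    refine Measurable.indicator ?_ (measurableSet_lt (by fun_prop) (by fun_prop))
    fun_prop
  have hmin : ∀ t : ℝ, 0 < t →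
      ENNReal.ofReal (t ^ (-p)) * ∫⁻ ω, ENNReal.ofReal (min t (Z ω) ^ p) ∂μ
        ≤ μ {ω | t ≤ Z ω} + ∫⁻ ω, k t ω ∂μ := by
    intro t ht
    have hs : MeasurableSet {ω | t ≤ Z ω} := measurableSet_le measurable_const hZ
    rw [← lintegral_indicator_one hs, ← lintegral_add_left (measurable_one.indicator hs),
      ← lintegral_const_mul _ (by fun_prop)]
    refine lintegral_mono fun ω => ?_
    rw [← ENNReal.ofReal_mul (by positivity)]
    rcases le_or_gt t (Z ω) with hle | hlt
    · rw [min_eq_left hle, ← Real.rpow_add ht]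
      simp [hle]
    · rw [min_eq_right hlt.le, mul_comm]
      simp [hk, Set.indicator_apply, hlt]
  have hk_int : ∫⁻ t in Set.Ioi (0 : ℝ), ∫⁻ ω, k t ω ∂μ
      ≤ ENNReal.ofReal (1 / (p - 1)) * ∫⁻ ω, ENNReal.ofReal (Z ω) ∂μ := by
    rw [lintegral_lintegral_swap hkm.aemeasurable, ← lintegral_const_mul _ (by fun_prop)]
    exact lintegral_mono fun ω => lintegral_Ioi_indicator_rpow_le hp (hZ0 ω)
  have hX0' : 0 ≤ᵐ[μ] X := Filter.Eventually.of_forall hX0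
  have hZ0' : 0 ≤ᵐ[μ] Z := Filter.Eventually.of_forall hZ0
  have hmono : Measurable fun t : ℝ => μ {ω | t ≤ Z ω} :=
    Antitone.measurable fun s t hst => measure_mono fun ω (hω : t ≤ Z ω) => hst.trans hω
  have hmono' : Measurable fun t : ℝ => μ {ω | t < Z ω} :=
    Antitone.measurable fun s t hst => measure_mono fun ω (hω : t < Z ω) => hst.trans_lt hω
  calc ∫⁻ ω, ENNReal.ofReal (X ω) ∂μ = ∫⁻ t in Set.Ioi (0 : ℝ), μ {ω | t < X ω} :=
        lintegral_eq_lintegral_meas_lt μ hX0' hX.aemeasurable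
    _ ≤ ∫⁻ t in Set.Ioi (0 : ℝ), (μ {ω | t < Z ω}
          + C * (μ {ω | t ≤ Z ω} + ∫⁻ ω, k t ω ∂μ)) := by
        refine setLIntegral_mono' measurableSet_Ioi fun t ht => (h t ht).trans ?_
        gcongr
        exact hmin t ht
    _ = ∫⁻ ω, ENNReal.ofReal (Z ω) ∂μ + C * (∫⁻ ω, ENNReal.ofReal (Z ω) ∂μ
          + ∫⁻ t in Set.Ioi (0 : ℝ), ∫⁻ ω, k t ω ∂μ) := by
        rw [lintegral_add_left hmono', lintegral_const_mul _ (by exact hmono.add hkm.lintegral_prod_right),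
          lintegral_add_left hmono, ← lintegral_eq_lintegral_meas_lt μ hZ0' hZ.aemeasurable,
          ← lintegral_eq_lintegral_meas_le μ hZ0' hZ.aemeasurable]
    _ ≤ _ := by
        rw [add_mul, one_mul, mul_assoc, add_mul, one_mul]
        gcongr

lemma lintegral_rpow_le_lintegral_mul_of_forall_meas_lt (μ : Measure Ω) [SFinite μ]
    {X Y : Ω → ℝ} (hX : Measurable X) (hX0 : ∀ ω, 0 ≤ X ω) (hY : Measurable Y)
    {q : ℝ} (hq : 1 < q) {C : ℝ≥0∞}
    (h : ∀ t : ℝ, 0 < t → ENNReal.ofReal t * μ {ω | 2 * t < X ω}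
      ≤ C * ∫⁻ ω in {ω | t < X ω}, ENNReal.ofReal (Y ω) ∂μ) :
    ∫⁻ ω, ENNReal.ofReal (X ω ^ q) ∂μ
      ≤ C * ENNReal.ofReal (2 ^ q * q / (q - 1))
        * ∫⁻ ω, ENNReal.ofReal (X ω ^ (q - 1)) * ENNReal.ofReal (Y ω) ∂μ := by
  set ν := μ.withDensity (fun ω => ENNReal.ofReal (Y ω)) with hν
  have hYm : Measurable fun ω => ENNReal.ofReal (Y ω) := by fun_prop
  have hνlt : ∀ t : ℝ, ν {ω | t < X ω} = ∫⁻ ω in {ω | t < X ω}, ENNReal.ofReal (Y ω) ∂μ :=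
    fun t => withDensity_apply _ (measurableSet_lt measurable_const hX)
  have hI : ∫⁻ ω, ENNReal.ofReal (X ω ^ (q - 1)) * ENNReal.ofReal (Y ω) ∂μ
      = ENNReal.ofReal (q - 1)
        * ∫⁻ t in Set.Ioi (0 : ℝ), ν {ω | t < X ω} * ENNReal.ofReal (t ^ (q - 1 - 1)) := by
    rw [← lintegral_rpow_eq_lintegral_meas_lt_mul ν (Filter.Eventually.of_forall hX0)
      hX.aemeasurable (by linarith), hν, lintegral_withDensity_eq_lintegral_mul _ hYm (by fun_prop)]
    simp [mul_comm]
  have hmν : Measurable fun t : ℝ => ν {ω | t < X ω} :=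
    Antitone.measurable fun s t hst => measure_mono fun ω (hω : t < X ω) => hst.trans_lt hω
  have hL := lintegral_rpow_eq_lintegral_meas_lt_mul μ (f := fun ω => X ω / 2)
    (Filter.Eventually.of_forall fun ω => div_nonneg (hX0 ω) zero_le_two)
    (by fun_prop) (by linarith : 0 < q)
  have hscale : ∫⁻ ω, ENNReal.ofReal (X ω ^ q) ∂μ
      = ENNReal.ofReal (2 ^ q) * ∫⁻ ω, ENNReal.ofReal ((X ω / 2) ^ q) ∂μ := by
    rw [← lintegral_const_mul _ (by fun_prop)]
    refine lintegral_congr fun ω => ?_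
    rw [← ENNReal.ofReal_mul (by positivity),
      ← Real.mul_rpow zero_le_two (div_nonneg (hX0 ω) zero_le_two)]
    congr 2; ring
  have hq1 : 0 < q - 1 := by linarith
  rw [hscale, hL, hI]
  calc _ ≤ ENNReal.ofReal (2 ^ q) * (ENNReal.ofReal q * ∫⁻ t in Set.Ioi (0 : ℝ),
          C * (ν {ω | t < X ω} * ENNReal.ofReal (t ^ (q - 1 - 1)))) := by
        gcongr _ * (_ * ?_)
        refine setLIntegral_mono' measurableSet_Ioi fun t (ht : 0 < t) => ?_
        have e : t ^ (q - 1) = t * t ^ (q - 1 - 1) := by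
          rw [← Real.rpow_one_add' ht.le (by linarith)]; congr 1; ring
        have e' : {ω | t < X ω / 2} = {ω | 2 * t < X ω} := by
          ext ω; simp only [Set.mem_ofPred_eq]; rw [lt_div_iff₀ two_pos, mul_comm]
        rw [e, e', ENNReal.ofReal_mul ht.le, ← mul_assoc, mul_comm (μ _), ← mul_assoc, hνlt]
        exact mul_le_mul' (h t ht) le_rfl
    _ = _ := by
        rw [lintegral_const_mul _ (by exact hmν.mul (by fun_prop)), mul_div_assoc, ENNReal.ofReal_mul (by positivity),
          ENNReal.ofReal_div_of_pos hq1, ENNReal.div_eq_inv_mul]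
        set J := ∫⁻ t in Set.Ioi (0 : ℝ), ν {ω | t < X ω} * ENNReal.ofReal (t ^ (q - 1 - 1))
        have : (ENNReal.ofReal (q - 1))⁻¹ * ENNReal.ofReal (q - 1) = 1 :=
          ENNReal.inv_mul_cancel (by simpa using hq) ENNReal.ofReal_ne_top
        calc _ = C * (ENNReal.ofReal (2 ^ q) * ENNReal.ofReal q) * (1 * J) := by ring
          _ = _ := by rw [← this]; ring

lemma lintegral_rpow_le_of_forall_meas_lt (μ : Measure Ω) [SFinite μ]
    {X Y : Ω → ℝ} (hX : Measurable X) (hX0 : ∀ ω, 0 ≤ X ω) (hY : Measurable Y)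
    (hY0 : ∀ ω, 0 ≤ Y ω) {c : ℝ} (hc : 0 ≤ c) (hXY : ∀ ω, X ω ≤ c * Y ω)
    {q : ℝ} (hq : 1 < q) {C : ℝ≥0∞}
    (h : ∀ t : ℝ, 0 < t → ENNReal.ofReal t * μ {ω | 2 * t < X ω}
      ≤ C * ∫⁻ ω in {ω | t < X ω}, ENNReal.ofReal (Y ω) ∂μ) :
    ∫⁻ ω, ENNReal.ofReal (X ω ^ q) ∂μ
      ≤ (C * ENNReal.ofReal (2 ^ q * q / (q - 1)) + 1) ^ q
        * ∫⁻ ω, ENNReal.ofReal (Y ω ^ q) ∂μ := by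
  have hq0 : 0 < q := by linarith
  set I := ∫⁻ ω, ENNReal.ofReal (X ω ^ q) ∂μ with hIdef
  set J := ∫⁻ ω, ENNReal.ofReal (Y ω ^ q) ∂μ with hJdef
  set D := C * ENNReal.ofReal (2 ^ q * q / (q - 1))
  have h1 := lintegral_rpow_le_lintegral_mul_of_forall_meas_lt μ hX hX0 hY hq h
  have hconj : (q / (q - 1)).HolderConjugate q := (Real.HolderConjugate.conjExponent hq).symm
  have h2 := ENNReal.lintegral_mul_le_Lp_mul_Lq μ hconj
    (f := fun ω => ENNReal.ofReal (X ω ^ (q - 1))) (g := fun ω => ENNReal.ofReal (Y ω))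
    (by fun_prop) (by fun_prop)
  have eX : ∀ ω, ENNReal.ofReal (X ω ^ (q - 1)) ^ (q / (q - 1)) = ENNReal.ofReal (X ω ^ q) := by
    intro ω
    rw [ENNReal.ofReal_rpow_of_nonneg (Real.rpow_nonneg (hX0 ω) _)
      (div_nonneg hq0.le (by linarith)), ← Real.rpow_mul (hX0 ω),
      mul_div_cancel₀ _ (by linarith : q - 1 ≠ 0)]
  have eY : ∀ ω, ENNReal.ofReal (Y ω) ^ q = ENNReal.ofReal (Y ω ^ q) := fun ω =>
    ENNReal.ofReal_rpow_of_nonneg (hY0 ω) hq0.le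
  simp only [Pi.mul_apply, eX, eY] at h2
  rw [← hIdef, ← hJdef] at h2
  have h3 : I ≤ D * (I ^ (1 / (q / (q - 1))) * J ^ (1 / q)) := h1.trans (by gcongr)
  rcases eq_or_ne J ∞ with hJ | hJ
  · rw [hJ, ENNReal.mul_top]
    · exact le_top
    · simp [hq0.le]
  have hItop : I ≠ ∞ := by
    have : I ≤ ENNReal.ofReal (c ^ q) * J := by
      rw [← lintegral_const_mul _ (by fun_prop)]
      refine lintegral_mono fun ω => ?_
      rw [← ENNReal.ofReal_mul (by positivity), ← Real.mul_rpow hc (hY0 ω)]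
      exact ENNReal.ofReal_le_ofReal (Real.rpow_le_rpow (hX0 ω) (hXY ω) hq0.le)
    exact ne_top_of_le_ne_top (ENNReal.mul_ne_top ENNReal.ofReal_ne_top hJ) this
  rcases eq_or_ne I 0 with hI0 | hI0
  · rw [hI0]; exact zero_le
  have hexp : 1 / (q / (q - 1)) = 1 - 1 / q := by
    have : q - 1 ≠ 0 := by linarith
    field_simp
  have h4 : I ^ (1 / q) ≤ D * J ^ (1 / q) := by
    have hpos : I ^ (1 - 1 / q) ≠ 0 := by simp [hI0, hItop]
    have htop : I ^ (1 - 1 / q) ≠ ∞ := by simp [hI0, hItop]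
    rw [← ENNReal.mul_le_mul_iff_right hpos htop, ← ENNReal.rpow_add _ _ hI0 hItop]
    rw [hexp] at h3
    calc _ = I := by simp
      _ ≤ _ := h3
      _ = _ := by ring
  calc I = (I ^ (1 / q)) ^ q := by rw [← ENNReal.rpow_mul, one_div_mul_cancel hq0.ne', rpow_one]
    _ ≤ ((D + 1) * J ^ (1 / q)) ^ q := by
        refine ENNReal.rpow_le_rpow (h4.trans ?_) hq0.le
        gcongr
        exact le_self_add
    _ = _ := by
        rw [ENNReal.mul_rpow_of_nonneg _ _ hq0.le, ← ENNReal.rpow_mul,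
          one_div_mul_cancel hq0.ne', rpow_one]

end Tails

/-! ### Martingale difference sequences -/

/-- A martingale difference sequence: `d n` is the increment between times `n` and `n + 1`. -/
structure IsMDS {Ω : Type} {mΩ : MeasurableSpace Ω} (μ : Measure Ω) (ℱ : Filtration ℕ mΩ)
    (d : ℕ → Ω → ℝ) : Prop where
  meas : ∀ n, StronglyMeasurable[ℱ (n + 1)] (d n)
  integrable : ∀ n, Integrable (d n) μ
  condExp_eq : ∀ n, μ[d n | ℱ n] =ᵐ[μ] 0

/-- The `ℓ^r` norm of the maximal functions of a family of sequences of functions. -/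
noncomputable def vecMax {Ω ι : Type} [Fintype ι] (r : ℝ) (d : ι → ℕ → Ω → ℝ) (N : ℕ) (ω : Ω) :
    ℝ :=
  lrNorm r (fun k => maxFn (fun n => d k n ω) N)

/-- The `ℓ^r` norm of the square functions of a family of sequences of functions. -/
noncomputable def vecSq {Ω ι : Type} [Fintype ι] (r : ℝ) (d : ι → ℕ → Ω → ℝ) (N : ℕ) (ω : Ω) :
    ℝ :=
  lrNorm r (fun k => sqFn (fun n => d k n ω) N)

/-- The maximal inequality in `L^p(ℓ^r)`, for finite families and a finite time horizon. -/
def BDG (p r : ℝ) : Prop :=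
  ∃ C : ℝ≥0∞, C ≠ ∞ ∧ ∀ (Ω : Type) (mΩ : MeasurableSpace Ω) (μ : Measure Ω),
    IsProbabilityMeasure μ → ∀ (ℱ : Filtration ℕ mΩ) (ι : Type) (_ : Fintype ι)
    (d : ι → ℕ → Ω → ℝ), (∀ k, IsMDS μ ℱ (d k)) → ∀ N : ℕ,
    ∫⁻ ω, ENNReal.ofReal (vecMax r d N ω ^ p) ∂μ
      ≤ C * ∫⁻ ω, ENNReal.ofReal (vecSq r d N ω ^ p) ∂μ

section Measurability

variable {Ω ι : Type} [Fintype ι] {m : MeasurableSpace Ω}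

lemma measurable_maxFn {d : ℕ → Ω → ℝ} {N : ℕ} (h : ∀ n < N, Measurable (d n)) :
    Measurable fun ω => maxFn (fun n => d n ω) N := by
  induction N with
  | zero => simp only [maxFn_zero]; exact measurable_const
  | succ N ih =>
    simp only [maxFn_succ]
    refine (ih fun n hn => h n (by lia)).max (Measurable.abs ?_)
    exact Finset.measurable_fun_sum _ fun n hn => h n (Finset.mem_range.1 hn)

lemma measurable_sqFn {d : ℕ → Ω → ℝ} {N : ℕ} (h : ∀ n < N, Measurable (d n)) :
    Measurable fun ω => sqFn (fun n => d n ω) N :=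
  Measurable.sqrt (Finset.measurable_fun_sum _ fun n hn => (h n (Finset.mem_range.1 hn)).pow_const 2)

lemma measurable_lrNorm {r : ℝ} {a : ι → Ω → ℝ} (h : ∀ k, Measurable (a k)) :
    Measurable fun ω => lrNorm r (fun k => a k ω) := by
  unfold lrNorm
  exact (Finset.measurable_fun_sum _ fun k _ => (h k).abs.pow_const r).pow_const _

lemma measurable_vecMax {r : ℝ} {d : ι → ℕ → Ω → ℝ} {N : ℕ}
    (h : ∀ k, ∀ n < N, Measurable (d k n)) : Measurable (vecMax r d N) :=
  measurable_lrNorm fun k => measurable_maxFn (h k)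

lemma measurable_vecSq {r : ℝ} {d : ι → ℕ → Ω → ℝ} {N : ℕ}
    (h : ∀ k, ∀ n < N, Measurable (d k n)) : Measurable (vecSq r d N) :=
  measurable_lrNorm fun k => measurable_sqFn (h k)

end Measurability

section MDS

variable {Ω ι : Type} [Fintype ι] {mΩ : MeasurableSpace Ω} {μ : Measure Ω} {ℱ : Filtration ℕ mΩ}

lemma vecMax_nonneg (r : ℝ) (d : ι → ℕ → Ω → ℝ) (N : ℕ) (ω : Ω) : 0 ≤ vecMax r d N ω :=
  lrNorm_nonneg _ _

lemma vecSq_nonneg (r : ℝ) (d : ι → ℕ → Ω → ℝ) (N : ℕ) (ω : Ω) : 0 ≤ vecSq r d N ω :=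
  lrNorm_nonneg _ _

lemma IsMDS.measurable_le {d : ℕ → Ω → ℝ} (hd : IsMDS μ ℱ d) {n N : ℕ} (h : n < N) :
    Measurable[ℱ N] (d n) :=
  (hd.meas n).measurable.mono (ℱ.mono h) le_rfl

lemma IsMDS.measurable {d : ℕ → Ω → ℝ} (hd : IsMDS μ ℱ d) (n : ℕ) : Measurable (d n) :=
  (hd.meas n).measurable.mono (ℱ.le _) le_rfl

lemma IsMDS.indicator [IsProbabilityMeasure μ] {d : ℕ → Ω → ℝ} (hd : IsMDS μ ℱ d)
    {s : ℕ → Set Ω} (hs : ∀ n, MeasurableSet[ℱ n] (s n)) :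
    IsMDS μ ℱ (fun n => (s n).indicator (d n)) where
  meas n := (hd.meas n).indicator (ℱ.mono n.le_succ _ (hs n))
  integrable n := (hd.integrable n).indicator (ℱ.le n _ (hs n))
  condExp_eq n := by
    refine (condExp_indicator (hd.integrable n) (hs n)).trans ?_
    filter_upwards [hd.condExp_eq n] with ω hω
    simp [hω]

lemma IsMDS.integral_mul_eq_zero [IsProbabilityMeasure μ] {d : ℕ → Ω → ℝ} (hd : IsMDS μ ℱ d)
    {n : ℕ} {G : Ω → ℝ} (hG : Measurable[ℱ n] G) (hGd : Integrable (fun ω => G ω * d n ω) μ) :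
    ∫ ω, G ω * d n ω ∂μ = 0 := by
  have h := condExp_mul_of_stronglyMeasurable_left (hG.stronglyMeasurable) hGd (hd.integrable n)
  rw [← integral_condExp (ℱ.le n)]
  refine integral_eq_zero_of_ae (h.trans ?_)
  filter_upwards [hd.condExp_eq n] with ω hω
  simp [hω]

/-- The integrated form of the pathwise Doob inequality in `L²`. -/
lemma IsMDS.lintegral_maxFn_sq_le [IsProbabilityMeasure μ] {d : ℕ → Ω → ℝ} (hd : IsMDS μ ℱ d)
    (N : ℕ) : ∫⁻ ω, ENNReal.ofReal (maxFn (fun n => d n ω) N ^ 2) ∂μ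
      ≤ 4 * ∫⁻ ω, ENNReal.ofReal (sqFn (fun n => d n ω) N ^ 2) ∂μ := by
  rcases eq_or_ne (∫⁻ ω, ENNReal.ofReal (sqFn (fun n => d n ω) N ^ 2) ∂μ) ∞ with htop | htop
  · simp [htop]
  have hSm : Measurable fun ω => sqFn (fun n => d n ω) N :=
    measurable_sqFn fun n _ => hd.measurable n
  have hMm : ∀ n, Measurable fun ω => maxFn (fun n => d n ω) n :=
    fun n => measurable_maxFn fun n _ => hd.measurable n
  have hS2 : Integrable (fun ω => sqFn (fun n => d n ω) N ^ 2) μ :=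
    ⟨(hSm.pow_const 2).aestronglyMeasurable, by
      rw [hasFiniteIntegral_iff_ofReal (Filter.Eventually.of_forall fun ω => sq_nonneg _)]
      exact lt_top_iff_ne_top.2 htop⟩
  have hS : MemLp (fun ω => sqFn (fun n => d n ω) N) 2 μ :=
    (memLp_two_iff_integrable_sq hSm.aestronglyMeasurable).2 hS2
  have hdL : ∀ n < N, MemLp (d n) 2 μ := fun n hn =>
    hS.mono' (hd.measurable n).aestronglyMeasurable
      (Filter.Eventually.of_forall fun ω => abs_le_sqFn (fun n => d n ω) hn)
  set G : ℕ → Ω → ℝ := fun n ω => 8 * (∑ m ∈ Finset.range n, d m ω)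
    - 4 * (maxFn (fun n => d n ω) n * SignType.sign (∑ m ∈ Finset.range n, d m ω)) with hG
  have hsign : Measurable fun x : ℝ => ((SignType.sign x : SignType) : ℝ) := by
    have : (fun x : ℝ => ((SignType.sign x : SignType) : ℝ))
        = fun x => if 0 < x then 1 else if x < 0 then -1 else 0 := by
      ext x
      rw [sign_apply]
      split_ifs <;> simp
    rw [this]
    exact Measurable.ite measurableSet_Ioi measurable_const
      (Measurable.ite measurableSet_Iio measurable_const measurable_const)
  have hGm : ∀ n, Measurable[ℱ n] (G n) := fun n => by
    have h1 : Measurable[ℱ n] fun ω => ∑ m ∈ Finset.range n, d m ω :=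
      Finset.measurable_fun_sum _ fun m hm => hd.measurable_le (Finset.mem_range.1 hm)
    exact (h1.const_mul 8).sub (((measurable_maxFn fun m hm => hd.measurable_le hm).mul
      (hsign.comp h1)).const_mul 4)
  have hGb : ∀ n ≤ N, ∀ ω, |G n ω| ≤ 12 * N * sqFn (fun n => d n ω) N := by
    intro n hn ω
    have h1 : |∑ m ∈ Finset.range n, d m ω| ≤ maxFn (fun n => d n ω) N :=
      abs_sum_le_maxFn (fun n => d n ω) hn
    have h2 := maxFn_mono (fun n => d n ω) hn
    have h3 := maxFn_le_mul_sqFn (fun n => d n ω) N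
    have h4 := maxFn_nonneg (fun n => d n ω) n
    have h5 : |((SignType.sign (∑ m ∈ Finset.range n, d m ω) : SignType) : ℝ)| ≤ 1 := by
      cases SignType.sign (∑ m ∈ Finset.range n, d m ω) <;> simp
    have h6 : |maxFn (fun n => d n ω) n * SignType.sign (∑ m ∈ Finset.range n, d m ω)|
        ≤ maxFn (fun n => d n ω) n := by
      rw [abs_mul, abs_of_nonneg h4]
      exact mul_le_of_le_one_right h4 h5
    rw [abs_le] at h1 h6
    rw [abs_le]
    constructor <;> simp only [hG] <;> linarith
  have hGL : ∀ n < N, MemLp (G n) 2 μ := fun n hn =>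
    (hS.const_mul (12 * N)).mono' ((hGm n).mono (ℱ.le n) le_rfl).aestronglyMeasurable
      (Filter.Eventually.of_forall fun ω => hGb n hn.le ω)
  have hGd : ∀ n ∈ Finset.range N, Integrable (fun ω => G n ω * d n ω) μ := fun n hn =>
    (hGL n (Finset.mem_range.1 hn)).integrable_mul (hdL n (Finset.mem_range.1 hn))
  have hM2 : Integrable (fun ω => maxFn (fun n => d n ω) N ^ 2) μ := by
    refine (memLp_two_iff_integrable_sq (hMm N).aestronglyMeasurable).1
      ((hS.const_mul N).mono' (hMm N).aestronglyMeasurable (Filter.Eventually.of_forall fun ω => ?_))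
    rw [Real.norm_of_nonneg (maxFn_nonneg _ _)]
    exact maxFn_le_mul_sqFn _ _
  rw [← ofReal_integral_eq_lintegral_ofReal hM2 (Filter.Eventually.of_forall fun ω => sq_nonneg _),
    ← ofReal_integral_eq_lintegral_ofReal hS2 (Filter.Eventually.of_forall fun ω => sq_nonneg _),
    ← ENNReal.ofReal_ofNat 4, ← ENNReal.ofReal_mul (by norm_num)]
  refine ENNReal.ofReal_le_ofReal ?_
  calc _ ≤ ∫ ω, (4 * sqFn (fun n => d n ω) N ^ 2 + ∑ n ∈ Finset.range N, G n ω * d n ω) ∂μ :=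
        integral_mono hM2 ((hS2.const_mul 4).add (integrable_finsetSum _ hGd))
          fun ω => maxFn_sq_le (fun n => d n ω) N
    _ = _ := by
        rw [integral_add (hS2.const_mul 4) (integrable_finsetSum _ hGd),
          integral_finsetSum _ hGd, integral_const_mul, Finset.sum_eq_zero, add_zero]
        exact fun n hn => hd.integral_mul_eq_zero (hGm n) (hGd n hn)

end MDS

lemma bdg_two_two : BDG 2 2 := by
  refine ⟨4, by simp, fun Ω mΩ μ hμ ℱ ι _ d hd N => ?_⟩
  simp only [vecMax, vecSq, lrNorm_rpow one_le_two, Real.rpow_two, sq_abs]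
  simp_rw [ENNReal.ofReal_sum_of_nonneg fun _ _ => sq_nonneg _]
  rw [lintegral_finsetSum _ fun k _ => ?_, lintegral_finsetSum _ fun k _ => ?_, Finset.mul_sum]
  · exact Finset.sum_le_sum fun k _ => (hd k).lintegral_maxFn_sq_le N
  · exact ((measurable_sqFn fun n _ => (hd k).measurable n).pow_const 2).ennreal_ofReal
  · exact ((measurable_maxFn fun n _ => (hd k).measurable n).pow_const 2).ennreal_ofReal

lemma BDG.self_of {p r : ℝ} (hp : 1 ≤ p) (h : BDG p r) (hr : 1 ≤ r) : BDG p p := by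
  obtain ⟨C, hC, h⟩ := h
  have hr0 : r ≠ 0 := by positivity
  refine ⟨C, hC, fun Ω mΩ μ hμ ℱ ι _ d hd N => ?_⟩
  have hsing : ∀ a : ℝ, 0 ≤ a → lrNorm r (fun _ : Unit => a) = a := fun a ha => by
    simp [lrNorm, abs_of_nonneg ha, ← Real.rpow_mul ha, hr0]
  simp only [vecMax, vecSq, lrNorm_rpow hp, abs_of_nonneg (maxFn_nonneg _ _),
    abs_of_nonneg (sqFn_nonneg _ _)]
  simp_rw [ENNReal.ofReal_sum_of_nonneg fun _ _ => Real.rpow_nonneg (maxFn_nonneg _ _) _,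
    ENNReal.ofReal_sum_of_nonneg fun _ _ => Real.rpow_nonneg (sqFn_nonneg _ _) _]
  rw [lintegral_finsetSum _ fun k _ => ?_, lintegral_finsetSum _ fun k _ => ?_, Finset.mul_sum]
  · refine Finset.sum_le_sum fun k _ => ?_
    have := h Ω mΩ μ hμ ℱ Unit inferInstance (fun _ => d k) (fun _ => hd k) N
    simpa only [vecMax, vecSq, hsing _ (maxFn_nonneg _ _), hsing _ (sqFn_nonneg _ _)] using this
  · exact ((measurable_sqFn fun n _ => (hd k).measurable n).pow_const p).ennreal_ofReal
  · exact ((measurable_maxFn fun n _ => (hd k).measurable n).pow_const p).ennreal_ofReal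

/-! ### Raising the exponent by stopping -/

section Stopping

variable {Ω ι : Type} [Fintype ι]

lemma vecMax_mono {r : ℝ} (hr : 1 ≤ r) (d : ι → ℕ → Ω → ℝ) (ω : Ω) :
    Monotone fun N => vecMax r d N ω := fun _ _ h =>
  lrNorm_le_of_le hr fun k => by
    rw [abs_of_nonneg (maxFn_nonneg _ _)]; exact maxFn_mono _ h

lemma vecSq_mono {r : ℝ} (hr : 1 ≤ r) (d : ι → ℕ → Ω → ℝ) (ω : Ω) :
    Monotone fun N => vecSq r d N ω := fun _ _ h =>
  lrNorm_le_of_le hr fun k => by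
    rw [abs_of_nonneg (sqFn_nonneg _ _)]; exact sqFn_mono _ h

lemma vecMax_zero {r : ℝ} (hr : 1 ≤ r) (d : ι → ℕ → Ω → ℝ) (ω : Ω) : vecMax r d 0 ω = 0 := by
  simp only [vecMax, maxFn_zero, lrNorm_zero hr]

lemma vecMax_le_mul_vecSq {r : ℝ} (hr : 1 ≤ r) (d : ι → ℕ → Ω → ℝ) (N : ℕ) (ω : Ω) :
    vecMax r d N ω ≤ N * vecSq r d N ω := by
  rw [vecSq, ← lrNorm_smul hr N.cast_nonneg]
  refine lrNorm_le_of_le hr fun k => ?_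
  rw [abs_of_nonneg (maxFn_nonneg _ _)]
  exact maxFn_le_mul_sqFn _ _

lemma maxFn_le_add_add {x y : ℕ → ℝ} {j N : ℕ} (h0 : ∀ n ≤ j, y n = 0)
    (h1 : ∀ n, j < n → n < N → y n = x n) :
    maxFn x N ≤ maxFn x j + |x j| + maxFn y N := by
  refine maxFn_le fun n hn => ?_
  have hy := maxFn_nonneg y N
  rcases le_or_gt n j with hnj | hnj
  · have := abs_sum_le_maxFn x hnj
    have := abs_nonneg (x j)
    linarith
  · have e : ∀ z : ℕ → ℝ, ∑ m ∈ Finset.range n, z m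
        = ∑ m ∈ Finset.range j, z m + z j + ∑ m ∈ Finset.Ico (j + 1) n, z m := fun z => by
      rw [← Finset.sum_range_succ, Finset.sum_range_add_sum_Ico _ hnj]
    have e' : ∑ m ∈ Finset.Ico (j + 1) n, x m = ∑ m ∈ Finset.range n, y m := by
      rw [e y, h0 j le_rfl, Finset.sum_eq_zero fun m hm => h0 m (Finset.mem_range.1 hm).le,
        zero_add, zero_add]
      refine Finset.sum_congr rfl fun m hm => (h1 m ?_ ?_).symm
      · exact (Finset.mem_Ico.1 hm).1
      · exact (Finset.mem_Ico.1 hm).2.trans_le hn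
    rw [e x, e']
    exact (abs_add_three _ _ _).trans (add_le_add (add_le_add_left (abs_sum_le_maxFn x le_rfl) _)
      (abs_sum_le_maxFn y hn))

/-- After the first time the maximal function exceeds `t`, the increments are kept. -/
lemma vecMax_le_of_lt {r : ℝ} (hr : 1 ≤ r) (d : ι → ℕ → Ω → ℝ) {N : ℕ} {t : ℝ} (ht : 0 < t)
    {ω : Ω} (hω : t < vecMax r d N ω) :
    vecMax r d N ω ≤ t + vecSq r d N ω
      + vecMax r (fun k n => {ω | t < vecMax r d n ω}.indicator (d k n)) N ω := by
  classical
  have hex : ∃ n, t < vecMax r d n ω := ⟨N, hω⟩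
  obtain ⟨j, hj⟩ : ∃ j, Nat.find hex = j + 1 := by
    refine Nat.exists_eq_succ_of_ne_zero fun h => ?_
    have := Nat.find_spec hex
    rw [h, vecMax_zero hr] at this
    linarith
  have hjN : j < N := by
    have := Nat.find_min' hex hω
    lia
  have hle : ∀ n ≤ j, vecMax r d n ω ≤ t := fun n hn => not_lt.1 (Nat.find_min hex (by lia))
  have hlt : ∀ n, j < n → t < vecMax r d n ω := fun n hn => by
    have := Nat.find_spec hex
    rw [hj] at this
    exact this.trans_le (vecMax_mono hr d ω hn)
  set y : ι → ℕ → ℝ := fun k n => {ω | t < vecMax r d n ω}.indicator (d k n) ω with hy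
  have h1 : ∀ k, maxFn (fun n => d k n ω) N
      ≤ maxFn (fun n => d k n ω) j + |d k j ω| + maxFn (y k) N := fun k => by
    refine maxFn_le_add_add (fun n hn => ?_) fun n hn _ => ?_
    · exact Set.indicator_of_notMem (by simpa using hle n hn) _
    · exact Set.indicator_of_mem (by simpa using hlt n hn) _
  have h2 : vecMax r d N ω ≤ vecMax r d j ω + lrNorm r (fun k => |d k j ω|)
      + lrNorm r fun k => maxFn (y k) N := by
    refine (lrNorm_le_of_le hr fun k => ?_).trans ((lrNorm_add_le hr _ _).trans
      (add_le_add_left (lrNorm_add_le hr _ _) _))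
    rw [abs_of_nonneg (maxFn_nonneg _ _)]
    exact h1 k
  refine h2.trans (add_le_add_left (add_le_add (hle j le_rfl) ?_) _)
  refine lrNorm_le_of_le hr fun k => ?_
  rw [abs_abs]
  exact abs_le_sqFn (fun n => d k n ω) hjN

lemma vecSq_indicator_le {r : ℝ} (hr : 1 ≤ r) (d : ι → ℕ → Ω → ℝ) (N : ℕ) (t : ℝ) (ω : Ω) :
    vecSq r (fun k n => {ω | t < vecMax r d n ω}.indicator (d k n)) N ω
      ≤ {ω | t < vecMax r d N ω}.indicator (vecSq r d N) ω := by
  by_cases hω : t < vecMax r d N ω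
  · rw [Set.indicator_of_mem (by exact hω)]
    refine lrNorm_le_of_le hr fun k => ?_
    rw [abs_of_nonneg (sqFn_nonneg _ _)]
    refine sqFn_mono_left fun n _ => ?_
    dsimp only
    rw [Set.indicator_apply]
    split_ifs <;> simp
  · rw [Set.indicator_of_notMem (by exact hω)]
    have h0 : ∀ k, sqFn (fun n => {ω | t < vecMax r d n ω}.indicator (d k n) ω) N = 0 := by
      intro k
      rw [sqFn_congr (y := fun _ => 0) fun n hn => ?_]
      · simp [sqFn]
      · have hn' : ¬ t < vecMax r d n ω := fun h => hω (h.trans_le (vecMax_mono hr d ω hn.le))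
        exact Set.indicator_of_notMem (by exact hn') _
    simp only [vecSq, h0, lrNorm_zero hr, le_refl]

end Stopping

lemma BDG.of_one {q r : ℝ} (hq : 1 ≤ q) (hr : 1 ≤ r) (h : BDG 1 r) : BDG q r := by
  rcases hq.eq_or_lt with rfl | hq
  · exact h
  obtain ⟨C, hC, h⟩ := h
  refine ⟨((1 + C) * ENNReal.ofReal (2 ^ q * q / (q - 1)) + 1) ^ q, by
    simp only [ne_eq, ENNReal.rpow_eq_top_iff, not_or, not_and_or]
    refine ⟨Or.inl (by simp), Or.inl ?_⟩
    exact ENNReal.add_ne_top.2 ⟨ENNReal.mul_ne_top (by simp [hC]) ENNReal.ofReal_ne_top, by simp⟩,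
    fun Ω mΩ μ hμ ℱ ι _ d hd N => ?_⟩
  have hXm : Measurable (vecMax r d N) := measurable_vecMax fun k n _ => (hd k).measurable n
  have hYm : Measurable (vecSq r d N) := measurable_vecSq fun k n _ => (hd k).measurable n
  refine lintegral_rpow_le_of_forall_meas_lt μ hXm (vecMax_nonneg r d N) hYm (vecSq_nonneg r d N)
    N.cast_nonneg (vecMax_le_mul_vecSq hr d N) hq fun t ht => ?_
  set d' : ι → ℕ → Ω → ℝ := fun k n => {ω | t < vecMax r d n ω}.indicator (d k n) with hd'
  have hMDS : ∀ k, IsMDS μ ℱ (d' k) := fun k => (hd k).indicator fun n =>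
    measurableSet_lt measurable_const (measurable_vecMax fun k m hm => (hd k).measurable_le hm)
  have hBDG := h Ω mΩ μ hμ ℱ ι ‹_› d' hMDS N
  simp only [Real.rpow_one] at hBDG
  have hs : MeasurableSet {ω | t < vecMax r d N ω} := measurableSet_lt measurable_const hXm
  have hs2 : MeasurableSet {ω | 2 * t < vecMax r d N ω} := measurableSet_lt measurable_const hXm
  have hpt : ∀ ω, {ω | 2 * t < vecMax r d N ω}.indicator (fun _ => ENNReal.ofReal t) ω
      ≤ {ω | t < vecMax r d N ω}.indicator (fun ω => ENNReal.ofReal (vecSq r d N ω)) ω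
        + ENNReal.ofReal (vecMax r d' N ω) := by
    intro ω
    by_cases hω : 2 * t < vecMax r d N ω
    · have hω' : t < vecMax r d N ω := by linarith
      rw [Set.indicator_of_mem (by exact hω), Set.indicator_of_mem (by exact hω'),
        ← ENNReal.ofReal_add (vecSq_nonneg _ _ _ _) (vecMax_nonneg _ _ _ _)]
      have := vecMax_le_of_lt hr d ht hω'
      exact ENNReal.ofReal_le_ofReal (by linarith)
    · rw [Set.indicator_of_notMem (by exact hω)]
      exact zero_le
  calc ENNReal.ofReal t * μ {ω | 2 * t < vecMax r d N ω}
      = ∫⁻ ω, {ω | 2 * t < vecMax r d N ω}.indicator (fun _ => ENNReal.ofReal t) ω ∂μ :=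
        (lintegral_indicator_const hs2 _).symm
    _ ≤ ∫⁻ ω in {ω | t < vecMax r d N ω}, ENNReal.ofReal (vecSq r d N ω) ∂μ
        + ∫⁻ ω, ENNReal.ofReal (vecMax r d' N ω) ∂μ := by
        rw [← lintegral_indicator hs, ← lintegral_add_left (hYm.ennreal_ofReal.indicator hs)]
        exact lintegral_mono hpt
    _ ≤ ∫⁻ ω in {ω | t < vecMax r d N ω}, ENNReal.ofReal (vecSq r d N ω) ∂μ
        + C * ∫⁻ ω in {ω | t < vecMax r d N ω}, ENNReal.ofReal (vecSq r d N ω) ∂μ := by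
        refine add_le_add_right (hBDG.trans (mul_le_mul_right (le_of_le_of_eq
          (lintegral_mono fun ω => ?_) (lintegral_indicator hs _)) _)) _
        refine (ENNReal.ofReal_le_ofReal (vecSq_indicator_le hr d N t ω)).trans ?_
        simp only [Set.indicator_apply]
        split_ifs <;> simp
    _ = _ := by ring

/-! ### The Davis decomposition -/

section Davis

variable {Ω ι : Type} [Fintype ι] {mΩ : MeasurableSpace Ω} {μ : Measure Ω} {ℱ : Filtration ℕ mΩ}

/-- Jensen's inequality for the `ℓ^r` norm of conditional expectations. -/
lemma lintegral_lrNorm_condExp_le [IsProbabilityMeasure μ] {r : ℝ} (hr : 1 ≤ r)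
    {m : MeasurableSpace Ω} (hm : m ≤ mΩ) {f : ι → Ω → ℝ} (hf : ∀ k, Integrable (f k) μ) :
    ∫⁻ ω, ENNReal.ofReal (lrNorm r (fun k => μ[f k | m] ω)) ∂μ
      ≤ ∫⁻ ω, ENNReal.ofReal (lrNorm r (fun k => f k ω)) ∂μ := by
  classical
  have hint : ∀ a : ι → Ω → ℝ, (∀ k, Integrable (a k) μ) →
      Integrable (fun ω => lrNorm r (fun k => a k ω)) μ := fun a ha => by
    refine Integrable.mono' (integrable_finsetSum Finset.univ fun k _ => (ha k).abs)
      ((continuous_lrNorm hr).comp_aestronglyMeasurable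
        (Integrable.of_eval ha).1) (Filter.Eventually.of_forall fun ω => ?_)
    rw [Real.norm_of_nonneg (lrNorm_nonneg _ _)]
    exact lrNorm_le_sum hr _
  have hF : Integrable (fun ω k => f k ω) μ := Integrable.of_eval hf
  have hcomp : ∀ᵐ ω ∂μ, ∀ k, μ[fun ω k => f k ω | m] ω k = μ[f k | m] ω := by
    refine ae_all_iff.2 fun k => ?_
    exact ContinuousLinearMap.comp_condExp_comm hF (ContinuousLinearMap.proj (R := ℝ) k)
  have hJ := ConvexOn.map_condExp_le_univ (φ := fun a : ι → ℝ => lrNorm r a) hm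
    (convexOn_lrNorm hr)
    (continuous_lrNorm hr).lowerSemicontinuous hF (hint f hf)
  rw [← ofReal_integral_eq_lintegral_ofReal (hint _ fun k => integrable_condExp)
      (Filter.Eventually.of_forall fun _ => lrNorm_nonneg _ _),
    ← ofReal_integral_eq_lintegral_ofReal (hint f hf)
      (Filter.Eventually.of_forall fun _ => lrNorm_nonneg _ _)]
  refine ENNReal.ofReal_le_ofReal ?_
  rw [← integral_condExp hm (f := fun ω => lrNorm r (fun k => f k ω))]
  refine integral_mono_ae (hint _ fun k => integrable_condExp) integrable_condExp ?_
  filter_upwards [hJ, hcomp] with ω h1 h2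
  rw [show (fun k => μ[f k | m] ω) = μ[fun ω k => f k ω | m] ω from funext fun k => (h2 k).symm]
  exact h1

lemma IsMDS.sub_add_condExp [IsProbabilityMeasure μ] {d b : ℕ → Ω → ℝ} (hd : IsMDS μ ℱ d)
    (hbm : ∀ n, StronglyMeasurable[ℱ (n + 1)] (b n)) (hbi : ∀ n, Integrable (b n) μ) :
    IsMDS μ ℱ (fun n => d n - b n + μ[b n | ℱ n]) where
  meas n := ((hd.meas n).sub (hbm n)).add (stronglyMeasurable_condExp.mono (ℱ.mono n.le_succ))
  integrable n := ((hd.integrable n).sub (hbi n)).add integrable_condExp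
  condExp_eq n := by
    have h1 := condExp_add ((hd.integrable n).sub (hbi n))
      (integrable_condExp (m := ℱ n) (f := b n)) (ℱ n)
    have h2 := condExp_sub (hd.integrable n) (hbi n) (ℱ n)
    have h3 : μ[μ[b n | ℱ n] | ℱ n] = μ[b n | ℱ n] :=
      condExp_of_stronglyMeasurable (ℱ.le n) stronglyMeasurable_condExp integrable_condExp
    filter_upwards [h1, h2, hd.condExp_eq n] with ω e1 e2 e3
    rw [e1, Pi.add_apply, e2, Pi.sub_apply, e3, h3]
    simp

/-- Truncating at a predictable bound for the square function. -/
lemma lintegral_vecMax_le_of_vecSq_le [IsProbabilityMeasure μ] {p r : ℝ} (hp : 1 < p)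
    (hr : 1 ≤ r) {C : ℝ≥0∞} {N : ℕ}
    (h : ∀ d : ι → ℕ → Ω → ℝ, (∀ k, IsMDS μ ℱ (d k)) →
      ∫⁻ ω, ENNReal.ofReal (vecMax r d (N + 1) ω ^ p) ∂μ
        ≤ C * ∫⁻ ω, ENNReal.ofReal (vecSq r d (N + 1) ω ^ p) ∂μ)
    {g : ι → ℕ → Ω → ℝ} (hg : ∀ k, IsMDS μ ℱ (g k)) {Z : ℕ → Ω → ℝ}
    (hZm : ∀ n, Measurable[ℱ n] (Z n)) (hZmono : ∀ ω, Monotone fun n => Z n ω)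
    (hgZ : ∀ n ω, vecSq r g (n + 1) ω ≤ Z n ω) :
    ∫⁻ ω, ENNReal.ofReal (vecMax r g (N + 1) ω) ∂μ
      ≤ (1 + C * (1 + ENNReal.ofReal (1 / (p - 1)))) * ∫⁻ ω, ENNReal.ofReal (Z N ω) ∂μ := by
  refine lintegral_le_of_forall_meas_lt_le μ (measurable_vecMax fun k n _ => (hg k).measurable n)
    (vecMax_nonneg r g _) ((hZm N).mono (ℱ.le N) le_rfl)
    (fun ω => (vecSq_nonneg r g _ ω).trans (hgZ N ω)) hp fun t ht => ?_
  set g' : ι → ℕ → Ω → ℝ := fun k n => {ω | Z n ω ≤ t}.indicator (g k n) with hg'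
  have hMDS : ∀ k, IsMDS μ ℱ (g' k) := fun k => (hg k).indicator fun n =>
    measurableSet_le (hZm n) measurable_const
  have habs : ∀ k n ω, |g' k n ω| ≤ |g k n ω| := fun k n ω => by
    simp only [hg', Set.indicator_apply]
    split_ifs <;> simp
  have hsq_le : ∀ n ω, vecSq r g' n ω ≤ vecSq r g n ω := fun n ω =>
    lrNorm_le_of_le hr fun k => by
      rw [abs_of_nonneg (sqFn_nonneg _ _)]
      exact sqFn_mono_left fun n _ => habs k n ω
  have hsq_t : ∀ n ω, vecSq r g' n ω ≤ t := fun n ω => by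
    induction n with
    | zero => simp only [vecSq, sqFn_zero, lrNorm_zero hr, ht.le]
    | succ n ih =>
      by_cases hn : Z n ω ≤ t
      · exact (hsq_le _ ω).trans ((hgZ n ω).trans hn)
      · have h0 : ∀ k, g' k n ω = 0 := fun k => Set.indicator_of_notMem (by exact hn) _
        have : vecSq r g' (n + 1) ω = vecSq r g' n ω := by
          unfold vecSq
          congr 1
          exact funext fun k => sqFn_succ_of_eq_zero (h0 k)
        rwa [this]
  have hmarkov : μ {ω | t ≤ vecMax r g' (N + 1) ω}
      ≤ ENNReal.ofReal (t ^ (-p)) * ∫⁻ ω, ENNReal.ofReal (vecMax r g' (N + 1) ω ^ p) ∂μ := by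
    have hm : Measurable (vecMax r g' (N + 1)) :=
      measurable_vecMax fun k n _ => (hMDS k).measurable n
    have htp : 0 < t ^ p := Real.rpow_pos_of_pos ht p
    have h1 := mul_meas_ge_le_lintegral₀ (μ := μ) (hm.pow_const p).ennreal_ofReal.aemeasurable
      (ENNReal.ofReal (t ^ p))
    rw [Real.rpow_neg ht.le, ENNReal.ofReal_inv_of_pos htp]
    rw [← ENNReal.mul_le_iff_le_inv (by simpa using htp) ENNReal.ofReal_ne_top]
    refine le_trans (mul_le_mul_right (measure_mono fun ω (hω : t ≤ _) => ?_) _) h1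
    exact ENNReal.ofReal_le_ofReal (Real.rpow_le_rpow ht.le hω (by linarith))
  calc μ {ω | t < vecMax r g (N + 1) ω}
      ≤ μ ({ω | t < Z N ω} ∪ {ω | t ≤ vecMax r g' (N + 1) ω}) := by
        refine measure_mono fun ω (hω : t < _) => ?_
        rcases lt_or_ge t (Z N ω) with hZ | hZ
        · exact Or.inl hZ
        · refine Or.inr (hω.le.trans_eq ?_)
          unfold vecMax
          congr 1
          refine funext fun k => maxFn_congr fun n hn => ?_
          exact (Set.indicator_of_mem
            (by exact (hZmono ω (Nat.lt_succ_iff.1 hn)).trans hZ) _).symm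
    _ ≤ μ {ω | t < Z N ω} + μ {ω | t ≤ vecMax r g' (N + 1) ω} := measure_union_le _ _
    _ ≤ μ {ω | t < Z N ω} + ENNReal.ofReal (t ^ (-p))
          * (C * ∫⁻ ω, ENNReal.ofReal (min t (Z N ω) ^ p) ∂μ) := by
        refine add_le_add_right (hmarkov.trans (mul_le_mul_right ((h g' hMDS).trans
          (mul_le_mul_right (lintegral_mono fun ω => ENNReal.ofReal_le_ofReal ?_) _)) _)) _
        exact Real.rpow_le_rpow (vecSq_nonneg _ _ _ _)
          (le_min (hsq_t _ ω) ((hsq_le _ ω).trans (hgZ N ω))) (by linarith)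
    _ = _ := by ring

/-- The jumps that are large compared with the past of the square function. -/
noncomputable def bigJump (r : ℝ) (d : ι → ℕ → Ω → ℝ) (k : ι) (n : ℕ) : Ω → ℝ :=
  {ω | 2 * vecSq r d n ω < lrNorm r (fun k => d k n ω)}.indicator (d k n)

lemma sum_lrNorm_bigJump_le {r : ℝ} (hr : 1 ≤ r) (d : ι → ℕ → Ω → ℝ) (N : ℕ) (ω : Ω) :
    ∑ n ∈ Finset.range N, lrNorm r (fun k => bigJump r d k n ω) ≤ 2 * vecSq r d N ω := by
  induction N with
  | zero => simpa using vecSq_nonneg r d 0 ω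
  | succ n ih =>
    rw [Finset.sum_range_succ]
    by_cases hω : 2 * vecSq r d n ω < lrNorm r (fun k => d k n ω)
    · have h1 : ∀ k, bigJump r d k n ω = d k n ω := fun k =>
        Set.indicator_of_mem (by exact hω) _
      have h2 : lrNorm r (fun k => d k n ω) ≤ vecSq r d (n + 1) ω :=
        lrNorm_le_of_le hr fun k => abs_le_sqFn (fun n => d k n ω) n.lt_succ_self
      simp only [h1]
      linarith
    · have h1 : ∀ k, bigJump r d k n ω = 0 := fun k =>
        Set.indicator_of_notMem (by exact hω) _
      have h2 := vecSq_mono hr d ω n.le_succ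
      simp only [h1, lrNorm_zero hr]
      dsimp only at h2
      linarith

lemma lrNorm_sub_bigJump_le {r : ℝ} (hr : 1 ≤ r) (d : ι → ℕ → Ω → ℝ) (n : ℕ) (ω : Ω) :
    lrNorm r (fun k => |d k n ω - bigJump r d k n ω|) ≤ 2 * vecSq r d n ω := by
  rw [lrNorm_abs]
  by_cases hω : 2 * vecSq r d n ω < lrNorm r (fun k => d k n ω)
  · have h1 : ∀ k, bigJump r d k n ω = d k n ω := fun k =>
      Set.indicator_of_mem (by exact hω) _
    simp only [h1, sub_self, lrNorm_zero hr]
    linarith [vecSq_nonneg r d n ω]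
  · have h1 : ∀ k, bigJump r d k n ω = 0 := fun k =>
      Set.indicator_of_notMem (by exact hω) _
    simp only [h1, sub_zero]
    exact not_lt.1 hω

lemma vecSq_sub_bigJump_add_le {r : ℝ} (hr : 1 ≤ r) (d c : ι → ℕ → Ω → ℝ) (n : ℕ) (ω : Ω) :
    vecSq r (fun k n => d k n - bigJump r d k n + c k n) (n + 1) ω
      ≤ 3 * vecSq r d n ω + ∑ m ∈ Finset.range (n + 1), lrNorm r (fun k => c k m ω) := by
  have h1 : ∀ k, sqFn (fun n => d k n ω - bigJump r d k n ω + c k n ω) (n + 1)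
      ≤ sqFn (fun n => d k n ω) n + |d k n ω - bigJump r d k n ω|
        + ∑ m ∈ Finset.range (n + 1), |c k m ω| := fun k => by
    refine (sqFn_add_le _ _ _).trans (add_le_add_left ((sqFn_succ_le _ _).trans
      (add_le_add_left (sqFn_mono_left fun m _ => ?_) _)) _)
    simp only [bigJump, Set.indicator_apply]
    split_ifs <;> simp
  have h2 : lrNorm r (fun k => ∑ m ∈ Finset.range (n + 1), |c k m ω|)
      ≤ ∑ m ∈ Finset.range (n + 1), lrNorm r (fun k => c k m ω) :=
    (lrNorm_sum_le hr (fun m k => |c k m ω|) _).trans_eq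
      (Finset.sum_congr rfl fun m _ => lrNorm_abs _ _)
  have h3 : vecSq r (fun k n => d k n - bigJump r d k n + c k n) (n + 1) ω
      ≤ vecSq r d n ω + lrNorm r (fun k => |d k n ω - bigJump r d k n ω|)
        + lrNorm r (fun k => ∑ m ∈ Finset.range (n + 1), |c k m ω|) := by
    refine (lrNorm_le_of_le hr fun k => ?_).trans ((lrNorm_add_le hr _ _).trans
      (add_le_add_left (lrNorm_add_le hr _ _) _))
    rw [abs_of_nonneg (sqFn_nonneg _ _)]
    exact h1 k
  linarith [lrNorm_sub_bigJump_le hr d n ω]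

lemma vecMax_le_sum_lrNorm {r : ℝ} (hr : 1 ≤ r) (d : ι → ℕ → Ω → ℝ) (N : ℕ) (ω : Ω) :
    vecMax r d N ω ≤ ∑ n ∈ Finset.range N, lrNorm r (fun k => d k n ω) := by
  refine (lrNorm_le_of_le hr fun k => ?_).trans ((lrNorm_sum_le hr (fun n k => |d k n ω|) N).trans_eq
    (Finset.sum_congr rfl fun m _ => lrNorm_abs _ _))
  rw [abs_of_nonneg (maxFn_nonneg _ _)]
  exact maxFn_le_sum_abs _ _

lemma vecMax_add_le {r : ℝ} (hr : 1 ≤ r) (d e : ι → ℕ → Ω → ℝ) (N : ℕ) (ω : Ω) :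
    vecMax r (fun k n => d k n + e k n) N ω ≤ vecMax r d N ω + vecMax r e N ω := by
  refine (lrNorm_le_of_le hr fun k => ?_).trans (lrNorm_add_le hr _ _)
  rw [abs_of_nonneg (maxFn_nonneg _ _)]
  exact maxFn_add_le _ _ _

end Davis

lemma BDG.one_of {p r : ℝ} (hp : 1 < p) (hr : 1 ≤ r) (h : BDG p r) : BDG 1 r := by
  obtain ⟨C, hC, h⟩ := h
  refine ⟨(1 + C * (1 + ENNReal.ofReal (1 / (p - 1)))) * 5 + 4, ?_,
    fun Ω mΩ μ hμ ℱ ι _ d hd N => ?_⟩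
  · refine ENNReal.add_ne_top.2 ⟨ENNReal.mul_ne_top ?_ (by simp), by simp⟩
    exact ENNReal.add_ne_top.2 ⟨by simp, ENNReal.mul_ne_top hC (by simp)⟩
  simp only [Real.rpow_one]
  rcases N with _ | N
  · simp [vecMax_zero hr]
  set b := bigJump r d with hb
  have hbm : ∀ k n, StronglyMeasurable[ℱ (n + 1)] (b k n) := fun k n =>
    ((hd k).meas n).indicator (measurableSet_lt (Measurable.const_mul (measurable_vecSq
      fun k m hm => (hd k).measurable_le (hm.trans n.lt_succ_self)) 2)
      (measurable_lrNorm fun k => (hd k).measurable_le n.lt_succ_self))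
  have hbi : ∀ k n, Integrable (b k n) μ := fun k n =>
    ((hd k).integrable n).indicator (measurableSet_lt (Measurable.const_mul (measurable_vecSq
      fun k m _ => (hd k).measurable m) 2) (measurable_lrNorm fun k => (hd k).measurable n))
  set c : ι → ℕ → Ω → ℝ := fun k n => μ[b k n | ℱ n] with hc
  have hcm : ∀ k n, Measurable[ℱ n] (c k n) := fun k n => stronglyMeasurable_condExp.measurable
  have hbm' : ∀ n, Measurable fun ω => lrNorm r (fun k => b k n ω) := fun n =>
    measurable_lrNorm fun k => (hbm k n).measurable.mono (ℱ.le _) le_rfl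
  have hcm' : ∀ n, Measurable fun ω => lrNorm r (fun k => c k n ω) := fun n =>
    measurable_lrNorm fun k => (hcm k n).mono (ℱ.le _) le_rfl
  set J := ∫⁻ ω, ENNReal.ofReal (vecSq r d (N + 1) ω) ∂μ with hJ
  have hB : ∑ n ∈ Finset.range (N + 1), ∫⁻ ω, ENNReal.ofReal (lrNorm r (fun k => b k n ω)) ∂μ
      ≤ 2 * J := by
    rw [← lintegral_finsetSum _ fun n _ => (hbm' n).ennreal_ofReal, hJ,
      ← lintegral_const_mul' _ _ (by simp)]
    refine lintegral_mono fun ω => ?_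
    rw [← ENNReal.ofReal_sum_of_nonneg fun _ _ => lrNorm_nonneg _ _, ← ENNReal.ofReal_ofNat 2,
      ← ENNReal.ofReal_mul zero_le_two]
    exact ENNReal.ofReal_le_ofReal (sum_lrNorm_bigJump_le hr d (N + 1) ω)
  have hCs : ∑ n ∈ Finset.range (N + 1), ∫⁻ ω, ENNReal.ofReal (lrNorm r (fun k => c k n ω)) ∂μ
      ≤ 2 * J :=
    (Finset.sum_le_sum fun n _ =>
      lintegral_lrNorm_condExp_le hr (ℱ.le n) fun k => hbi k n).trans hB
  set g : ι → ℕ → Ω → ℝ := fun k n => d k n - b k n + c k n with hg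
  have hgMDS : ∀ k, IsMDS μ ℱ (g k) := fun k => (hd k).sub_add_condExp (hbm k) (hbi k)
  set Z : ℕ → Ω → ℝ := fun n ω =>
    3 * vecSq r d n ω + ∑ m ∈ Finset.range (n + 1), lrNorm r (fun k => c k m ω) with hZ
  have hZm : ∀ n, Measurable[ℱ n] (Z n) := fun n =>
    (Measurable.const_mul (measurable_vecSq fun k m hm => (hd k).measurable_le hm) 3).add
      (Finset.measurable_fun_sum _ fun m hm => measurable_lrNorm fun k =>
        (hcm k m).mono (ℱ.mono (Nat.lt_succ_iff.1 (Finset.mem_range.1 hm))) le_rfl)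
  have hZmono : ∀ ω, Monotone fun n => Z n ω := fun ω i j hij =>
    add_le_add (mul_le_mul_of_nonneg_left (vecSq_mono hr d ω hij) (by norm_num))
      (Finset.sum_le_sum_of_subset_of_nonneg (Finset.range_mono (Nat.succ_le_succ hij))
        fun _ _ _ => lrNorm_nonneg _ _)
  have hgZ : ∀ n ω, vecSq r g (n + 1) ω ≤ Z n ω := vecSq_sub_bigJump_add_le hr d c
  have hN : ∀ d : ι → ℕ → Ω → ℝ, (∀ k, IsMDS μ ℱ (d k)) →
      ∫⁻ ω, ENNReal.ofReal (vecMax r d (N + 1) ω ^ p) ∂μ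
        ≤ C * ∫⁻ ω, ENNReal.ofReal (vecSq r d (N + 1) ω ^ p) ∂μ :=
    fun d hd => h Ω mΩ μ hμ ℱ ι _ d hd (N + 1)
  have hgood := lintegral_vecMax_le_of_vecSq_le hp hr hN hgMDS hZm hZmono hgZ
  have hZint : ∫⁻ ω, ENNReal.ofReal (Z N ω) ∂μ ≤ 5 * J := by
    have hpt : ∀ ω, ENNReal.ofReal (Z N ω) ≤ 3 * ENNReal.ofReal (vecSq r d (N + 1) ω)
        + ∑ n ∈ Finset.range (N + 1), ENNReal.ofReal (lrNorm r (fun k => c k n ω)) := fun ω => by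
      rw [← ENNReal.ofReal_sum_of_nonneg fun _ _ => lrNorm_nonneg _ _, ← ENNReal.ofReal_ofNat 3,
        ← ENNReal.ofReal_mul (by norm_num), ← ENNReal.ofReal_add
          (mul_nonneg (by norm_num) (vecSq_nonneg _ _ _ _))
          (Finset.sum_nonneg fun _ _ => lrNorm_nonneg _ _)]
      exact ENNReal.ofReal_le_ofReal (add_le_add_left (mul_le_mul_of_nonneg_left
        (vecSq_mono hr d ω N.le_succ) (by norm_num)) _)
    refine (lintegral_mono hpt).trans ?_
    rw [lintegral_add_right _ (Finset.measurable_fun_sum _ fun n _ => (hcm' n).ennreal_ofReal),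
      lintegral_finsetSum _ fun n _ => (hcm' n).ennreal_ofReal, lintegral_const_mul' _ _ (by simp)]
    exact (add_le_add_right hCs _).trans_eq (by ring)
  have hpt : ∀ ω, ENNReal.ofReal (vecMax r d (N + 1) ω) ≤ ENNReal.ofReal (vecMax r g (N + 1) ω)
      + (∑ n ∈ Finset.range (N + 1), ENNReal.ofReal (lrNorm r (fun k => b k n ω))
        + ∑ n ∈ Finset.range (N + 1), ENNReal.ofReal (lrNorm r (fun k => c k n ω))) := fun ω => by
    have h0 : ∀ a : ι → ℕ → Ω → ℝ,
        0 ≤ ∑ n ∈ Finset.range (N + 1), lrNorm r (fun k => a k n ω) := fun a =>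
      Finset.sum_nonneg fun _ _ => lrNorm_nonneg _ _
    rw [← ENNReal.ofReal_sum_of_nonneg fun _ _ => lrNorm_nonneg _ _,
      ← ENNReal.ofReal_sum_of_nonneg fun _ _ => lrNorm_nonneg _ _,
      ← ENNReal.ofReal_add (h0 b) (h0 c),
      ← ENNReal.ofReal_add (vecMax_nonneg _ _ _ _) (add_nonneg (h0 b) (h0 c))]
    refine ENNReal.ofReal_le_ofReal ?_
    have e : d = fun k n => g k n + (b k n - c k n) := by
      funext k n
      simp only [hg]
      ring
    calc vecMax r d (N + 1) ω = vecMax r (fun k n => g k n + (b k n - c k n)) (N + 1) ω := by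
          rw [← e]
      _ ≤ vecMax r g (N + 1) ω + vecMax r (fun k n => b k n - c k n) (N + 1) ω :=
          vecMax_add_le hr g (fun k n => b k n - c k n) _ _
      _ ≤ _ := by
          refine add_le_add_right ((vecMax_le_sum_lrNorm hr _ _ _).trans ?_) _
          rw [← Finset.sum_add_distrib]
          exact Finset.sum_le_sum fun n _ => lrNorm_sub_le hr _ _
  refine (lintegral_mono hpt).trans ?_
  rw [lintegral_add_right _ (by
      exact (Finset.measurable_fun_sum _ fun n _ => (hbm' n).ennreal_ofReal).add
        (Finset.measurable_fun_sum _ fun n _ => (hcm' n).ennreal_ofReal)),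
    lintegral_add_right _ (Finset.measurable_fun_sum _ fun n _ => (hcm' n).ennreal_ofReal),
    lintegral_finsetSum _ fun n _ => (hcm' n).ennreal_ofReal,
    lintegral_finsetSum _ fun n _ => (hbm' n).ennreal_ofReal]
  calc _ ≤ (1 + C * (1 + ENNReal.ofReal (1 / (p - 1)))) * (5 * J) + (2 * J + 2 * J) :=
        add_le_add (hgood.trans (mul_le_mul_right hZint _)) (add_le_add hB hCs)
    _ = _ := by ring

lemma bdg {q r : ℝ} (hq : 1 ≤ q) (hr : 1 ≤ r) : BDG q r := by
  refine BDG.of_one hq hr ?_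
  have h12 : BDG 1 2 := BDG.one_of one_lt_two one_le_two bdg_two_two
  rcases hr.eq_or_lt with rfl | hr'
  · exact h12.self_of le_rfl one_le_two
  · exact ((h12.of_one hr one_le_two).self_of hr one_le_two).one_of hr' hr

/-! ### Passage to countable families and an infinite time horizon -/

lemma ofReal_lrNorm_rpow {ι : Type} [Fintype ι] {r q : ℝ} (hr : 1 ≤ r) (hq : 1 ≤ q) {a : ι → ℝ}
    (ha : ∀ k, 0 ≤ a k) :
    ENNReal.ofReal (lrNorm r a ^ q) = ((∑ k, ENNReal.ofReal (a k) ^ r) ^ (1 / r)) ^ q := by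
  have hr0 : 0 ≤ r := by positivity
  have hq0 : 0 ≤ q := by positivity
  rw [← ENNReal.ofReal_rpow_of_nonneg (lrNorm_nonneg _ _) hq0, lrNorm,
    ← ENNReal.ofReal_rpow_of_nonneg (Finset.sum_nonneg fun _ _ => by positivity) (by positivity),
    ENNReal.ofReal_sum_of_nonneg fun _ _ => by positivity]
  simp_rw [abs_of_nonneg (ha _), ← ENNReal.ofReal_rpow_of_nonneg (ha _) hr0]

lemma ENNReal.tsum_iSup_le_iSup_sum {f : ℕ → ℕ → ℝ≥0∞} (hf : ∀ k, Monotone (f k)) :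
    ∑' k, ⨆ n, f k n ≤ ⨆ N, ∑ k ∈ Finset.range N, f k N := by
  rw [ENNReal.tsum_eq_iSup_nat]
  refine iSup_le fun K => ?_
  rw [ENNReal.finsetSum_iSup_of_monotone hf]
  refine iSup_le fun n => le_iSup_of_le (max K n) ?_
  exact (Finset.sum_le_sum fun k _ => hf k (le_max_right K n)).trans
    (Finset.sum_le_sum_of_subset (Finset.range_mono (le_max_left K n)))

lemma isMDS_of_martingale {Ω : Type} {mΩ : MeasurableSpace Ω} {μ : Measure Ω}
    [IsProbabilityMeasure μ] {ℱ : Filtration ℕ mΩ} {h : ℕ → Ω → ℝ} (hh : Martingale h ℱ μ) :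
    IsMDS μ ℱ (fun n ω => h (n + 1) ω - h n ω) where
  meas n := (hh.1 (n + 1)).sub ((hh.1 n).mono (ℱ.mono n.le_succ))
  integrable n := (hh.integrable (n + 1)).sub (hh.integrable n)
  condExp_eq n := by
    filter_upwards [condExp_sub (hh.integrable (n + 1)) (hh.integrable n) (ℱ n),
      hh.2 n (n + 1) n.le_succ, hh.2 n n le_rfl] with ω h1 h2 h3
    refine h1.trans ?_
    rw [Pi.sub_apply, h2, h3, sub_self, Pi.zero_apply]

lemma lintegral_maxFn_tsum_le {q r : ℝ} (hq : 1 ≤ q) (hr : 1 ≤ r) :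
    ∃ C : ℝ≥0∞, C ≠ ∞ ∧ ∀ (Ω : Type) (mΩ : MeasurableSpace Ω) (μ : Measure Ω),
      IsProbabilityMeasure μ → ∀ (ℱ : Filtration ℕ mΩ) (d : ℕ → ℕ → Ω → ℝ),
      (∀ k, IsMDS μ ℱ (d k)) →
      ∫⁻ ω, ((∑' k, (⨆ n, ENNReal.ofReal |∑ m ∈ Finset.range n, d k m ω|) ^ r) ^ (1 / r)) ^ q ∂μ
        ≤ C * ∫⁻ ω, ((∑' k, ((∑' n, ENNReal.ofReal (d k n ω ^ 2)) ^ ((2 : ℝ)⁻¹)) ^ r)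
          ^ (1 / r)) ^ q ∂μ := by
  obtain ⟨C, hC, h⟩ := bdg hq hr
  have hr0 : 0 < r := by positivity
  have hq0 : 0 < q := by positivity
  refine ⟨C, hC, fun Ω mΩ μ hμ ℱ d hd => ?_⟩
  set e : ∀ N : ℕ, Fin N → ℕ → Ω → ℝ := fun N k => d k with he
  set F : ℕ → Ω → ℝ≥0∞ := fun N ω =>
    ∑ k ∈ Finset.range N, ENNReal.ofReal (maxFn (fun n => d k n ω) N) ^ r with hF
  have hmono : ∀ k ω, Monotone fun N => ENNReal.ofReal (maxFn (fun n => d k n ω) N) ^ r :=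
    fun k ω i j hij => by
      have := maxFn_mono (fun n => d k n ω) hij
      dsimp only
      gcongr
  have hFmono : ∀ ω, Monotone fun N => F N ω := fun ω i j hij =>
    (Finset.sum_le_sum fun k _ => hmono k ω hij).trans
      (Finset.sum_le_sum_of_subset (Finset.range_mono hij))
  have hmax : ∀ N ω, ENNReal.ofReal (vecMax r (e N) N ω ^ q) = (F N ω ^ (1 / r)) ^ q :=
    fun N ω => by
      rw [vecMax, ofReal_lrNorm_rpow hr hq fun k => maxFn_nonneg _ _]
      simp only [hF, Finset.sum_range, he]
  have hmeas : ∀ N, Measurable fun ω => (F N ω ^ (1 / r)) ^ q := fun N => by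
    simp_rw [← hmax]
    exact ((measurable_vecMax (ι := Fin N) fun k n _ => (hd k).measurable n).pow_const q).ennreal_ofReal
  have hleft : ∀ ω,
      ((∑' k, (⨆ n, ENNReal.ofReal |∑ m ∈ Finset.range n, d k m ω|) ^ r) ^ (1 / r)) ^ q
        ≤ ⨆ N, (F N ω ^ (1 / r)) ^ q := fun ω => by
    have hs : 0 < 1 / r * q := by positivity
    have hsup : ∑' k, (⨆ n, ENNReal.ofReal |∑ m ∈ Finset.range n, d k m ω|) ^ r ≤ ⨆ N, F N ω := by
      refine le_trans (ENNReal.tsum_le_tsum fun k => ?_)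
        (ENNReal.tsum_iSup_le_iSup_sum fun k => hmono k ω)
      rw [← ENNReal.orderIsoRpow_apply r hr0, OrderIso.map_iSup]
      refine iSup_mono fun n => ?_
      rw [ENNReal.orderIsoRpow_apply]
      have := abs_sum_le_maxFn (fun n => d k n ω) (le_refl n)
      gcongr
    simp_rw [← ENNReal.rpow_mul, ← ENNReal.orderIsoRpow_apply (1 / r * q) hs]
    rw [← OrderIso.map_iSup]
    exact (ENNReal.orderIsoRpow _ hs).monotone hsup
  have hsq : ∀ N ω, ENNReal.ofReal (vecSq r (e N) N ω ^ q)
      ≤ ((∑' k, ((∑' n, ENNReal.ofReal (d k n ω ^ 2)) ^ ((2 : ℝ)⁻¹)) ^ r) ^ (1 / r)) ^ q :=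
    fun N ω => by
      rw [vecSq, ofReal_lrNorm_rpow hr hq fun k => sqFn_nonneg _ _]
      have hk : ∀ k, ENNReal.ofReal (sqFn (fun n => d k n ω) N)
          ≤ (∑' n, ENNReal.ofReal (d k n ω ^ 2)) ^ ((2 : ℝ)⁻¹) := fun k => by
        rw [sqFn, Real.sqrt_eq_rpow, ← ENNReal.ofReal_rpow_of_nonneg
          (Finset.sum_nonneg fun _ _ => sq_nonneg _) (by norm_num),
          ENNReal.ofReal_sum_of_nonneg fun _ _ => sq_nonneg _, one_div]
        gcongr
        exact ENNReal.sum_le_tsum _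
      have hsum : ∑ k : Fin N, ENNReal.ofReal (sqFn (fun n => e N k n ω) N) ^ r
          ≤ ∑' k, ((∑' n, ENNReal.ofReal (d k n ω ^ 2)) ^ ((2 : ℝ)⁻¹)) ^ r := by
        rw [← Finset.sum_range fun k => ENNReal.ofReal (sqFn (fun n => d k n ω) N) ^ r]
        refine (Finset.sum_le_sum fun k _ => ?_).trans (ENNReal.sum_le_tsum (Finset.range N))
        exact ENNReal.rpow_le_rpow (hk k) hr0.le
      exact ENNReal.rpow_le_rpow (ENNReal.rpow_le_rpow hsum (by positivity)) hq0.le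
  refine (lintegral_mono hleft).trans ?_
  rw [lintegral_iSup hmeas fun i j hij ω => ENNReal.rpow_le_rpow
    (ENNReal.rpow_le_rpow (hFmono ω hij) (by positivity)) hq0.le]
  refine iSup_le fun N => ?_
  simp_rw [← hmax]
  exact (h Ω mΩ μ hμ ℱ (Fin N) inferInstance (e N) (fun k => hd k) N).trans
    (mul_le_mul_right (lintegral_mono (hsq N)) _)

/-- vector-valued Burkholder–Davis–Gundy inequality,
`‖ (Σ_k (M h^{(k)})^r)^{1/r} ‖_{L^q} ≲_{q,r} ‖ (Σ_k (S h^{(k)})^r)^{1/r} ‖_{L^q}`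
for `1 ≤ q < ∞`, `1 ≤ r < ∞`, including the endpoint `q = 1`. -/
theorem vector_valued_BDG (q r : ℝ) (hq : 1 ≤ q) (hr : 1 ≤ r) :
    ∃ C : ℝ≥0∞, C < ∞ ∧
      ∀ (Ω : Type) (mΩ : MeasurableSpace Ω) (μ : Measure Ω), IsProbabilityMeasure μ →
      ∀ (ℱ : Filtration ℕ mΩ) (h : ℕ → ℕ → Ω → ℝ),
        (∀ k, Martingale (h k) ℱ μ) →
        (∀ k ω, h k 0 ω = 0) →
        (∫⁻ ω, ((∑' k : ℕ, (⨆ n : ℕ, ENNReal.ofReal |h k n ω|) ^ r) ^ (1 / r)) ^ q ∂μ) ^ (1 / q)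
          ≤ C * (∫⁻ ω, ((∑' k : ℕ,
                ((∑' n : ℕ, ENNReal.ofReal ((h k (n + 1) ω - h k n ω) ^ 2)) ^ ((2 : ℝ)⁻¹)) ^ r)
                  ^ (1 / r)) ^ q ∂μ) ^ (1 / q) := by
  obtain ⟨C, hC, hbdg⟩ := lintegral_maxFn_tsum_le hq hr
  have hq0 : 0 ≤ 1 / q := by positivity
  refine ⟨C ^ (1 / q), ENNReal.rpow_lt_top_of_nonneg hq0 hC,
    fun Ω mΩ μ hμ ℱ h hM h0 => ?_⟩
  have key := hbdg Ω mΩ μ hμ ℱ (fun k n ω => h k (n + 1) ω - h k n ω)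
    fun k => isMDS_of_martingale (hM k)
  have hsum : ∀ k n ω, ∑ m ∈ Finset.range n, (h k (m + 1) ω - h k m ω) = h k n ω := by
    intro k n ω
    rw [Finset.sum_range_sub (fun m => h k m ω), h0, sub_zero]
  simp only [hsum] at key
  rw [← ENNReal.mul_rpow_of_nonneg _ _ hq0]
  exact ENNReal.rpow_le_rpow key hq0
end

section
/- Weighted BDG inequality: for any real-valued martingale (f_n) and any nonnegative random variable w, E[Mf · w] ≤ 16(√2+1) E[Sf · Mw], where Mf = sup_n |f_n|, Sf = (Σ_n |df_n|²)^{1/2}, and Mw = sup_n E[w | ℱ_n]. -/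
open MeasureTheory ENNReal

set_option maxHeartbeats 1000000 in
lemma davis_step {x d m m' q s s' a a' : ℝ} (hx : |x| ≤ m) (hm' : m' = max m |x + d|)
    (hs : 0 ≤ s) (hs' : 0 ≤ s') (ha : 0 ≤ a) (ha' : 0 ≤ a')
    (hsq : s ^ 2 = q) (hsq' : s' ^ 2 = q + d ^ 2) (haq : a ^ 2 = q + m ^ 2)
    (haq' : a' ^ 2 = q + d ^ 2 + m' ^ 2) :
    (x + d) ^ 2 / (2 * a') + (a' + (q + d ^ 2) / a') / 2 - 12 * s'
      ≤ x ^ 2 / (2 * a) + (a + q / a) / 2 - 12 * s + x / a * d := by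
  have hm0 : 0 ≤ m := (abs_nonneg x).trans hx
  have hmm' : m ≤ m' := hm' ▸ le_max_left _ _
  have hxm' : |x + d| ≤ m' := hm' ▸ le_max_right _ _
  have hm'0 : 0 ≤ m' := hm0.trans hmm'
  have hm'd : m' ≤ m + |d| := by
    rw [hm']
    exact max_le (by linarith [abs_nonneg d]) ((abs_add_le x d).trans (by linarith))
  have hx'2 : (x + d) ^ 2 ≤ m' ^ 2 := sq_le_sq' (by linarith [neg_abs_le (x + d)])
    ((le_abs_self _).trans hxm')
  have hd2 : |d| ^ 2 = d ^ 2 := sq_abs d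
  have hd0 := abs_nonneg d
  have hq : 0 ≤ q := hsq ▸ sq_nonneg s
  have hsa : s ≤ a := abs_le_of_sq_le_sq' (by nlinarith [sq_nonneg m]) ha |>.2
  have hma : m ≤ a := abs_le_of_sq_le_sq' (by nlinarith) ha |>.2
  have hss' : s ≤ s' := abs_le_of_sq_le_sq' (by nlinarith [sq_nonneg d]) hs' |>.2
  have h1 : (x + d) ^ 2 / (2 * a') ≤ a' / 2 := by
    apply div_le_of_le_mul₀ (by linarith) (by linarith)
    nlinarith [sq_nonneg d]
  have h2 : (q + d ^ 2) / a' ≤ a' := by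
    apply div_le_of_le_mul₀ ha' ha'
    nlinarith [sq_nonneg m']
  rcases lt_or_ge a |d| with hbig | hsmall
  · have h3 : a' ≤ 9 / 4 * |d| := by
      refine abs_le_of_sq_le_sq' ?_ (by linarith) |>.2
      nlinarith
    have h4 : s + 2 / 5 * |d| ≤ s' := by
      refine abs_le_of_sq_le_sq' ?_ hs' |>.2
      nlinarith
    have h5 : -|d| ≤ x / a * d := by
      have : |x / a * d| ≤ |d| := by
        rw [abs_mul, abs_div, abs_of_nonneg ha]
        exact mul_le_of_le_one_left hd0 (div_le_one_of_le₀ (hx.trans hma) ha)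
      linarith [neg_abs_le (x / a * d)]
    have h6 : 0 ≤ x ^ 2 / (2 * a) := by positivity
    have h7 : 0 ≤ q / a := by positivity
    linarith
  · rcases ha.eq_or_lt with h0 | hapos
    · have hd : d = 0 := abs_eq_zero.mp (le_antisymm (h0 ▸ hsmall) hd0)
      have hx0 : x = 0 := abs_eq_zero.mp (le_antisymm (by linarith) (abs_nonneg x))
      subst hd hx0
      have hm00 : m = 0 := le_antisymm (by linarith) hm0
      have : a' = 0 := by
        have : m' = 0 := by simp [hm', hm00]
        have hs0 : s = 0 := le_antisymm (by linarith) hs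
        have : a' ^ 2 = 0 := by rw [haq', ← hsq, hs0, this]; norm_num
        simpa using this
      simp [this, ← h0]
      linarith
    · obtain ⟨b, hb, hbq⟩ : ∃ b : ℝ, 0 ≤ b ∧ b ^ 2 = q + d ^ 2 + m ^ 2 :=
        ⟨√(q + d ^ 2 + m ^ 2), Real.sqrt_nonneg _, Real.sq_sqrt (by positivity)⟩
      have hab : a ≤ b := abs_le_of_sq_le_sq' (by nlinarith [sq_nonneg d]) hb |>.2
      have hba' : b ≤ a' := abs_le_of_sq_le_sq' (by nlinarith [sq_nonneg d]) ha' |>.2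
      have hbpos : 0 < b := hapos.trans_le hab
      have ha'pos : 0 < a' := hbpos.trans_le hba'
      have hs'a : s' ≤ 3 / 2 * a := by
        refine abs_le_of_sq_le_sq' ?_ (by linarith) |>.2
        have := mul_self_le_mul_self hs hsa
        have := mul_self_le_mul_self hd0 hsmall
        nlinarith
      have hd2a : d ^ 2 / a ≤ 5 / 2 * (s' - s) := by
        rw [div_le_iff₀ hapos]
        calc d ^ 2 = (s' - s) * (s' + s) := by linear_combination hsq - hsq'
          _ ≤ (s' - s) * (5 / 2 * a) :=
            mul_le_mul_of_nonneg_left (by linarith) (sub_nonneg.2 hss')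
          _ = 5 / 2 * (s' - s) * a := by ring
      have hB : b - a ≤ d ^ 2 / a / 2 := by
        rw [div_div, le_div_iff₀ (by positivity)]
        calc (b - a) * (a * 2) ≤ (b - a) * (b + a) :=
            mul_le_mul_of_nonneg_left (by linarith) (sub_nonneg.2 hab)
          _ = d ^ 2 := by linear_combination hbq - haq
      have hB2 : (q + d ^ 2) / b ≤ q / a + d ^ 2 / a := by
        rw [← add_div]
        gcongr
      have hfirst : (x + d) ^ 2 / (2 * a') - (x + d) ^ 2 / (2 * a)
          + (a' + (q + d ^ 2) / a') / 2 - (b + (q + d ^ 2) / b) / 2 ≤ 0 := by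
        rcases max_cases m |x + d| with ⟨h, -⟩ | ⟨h, -⟩
        · have : a' = b := by
            rw [h] at hm'
            rw [← Real.sqrt_sq ha', ← Real.sqrt_sq hb, haq', hbq, hm']
          rw [this]
          have : (x + d) ^ 2 / (2 * b) ≤ (x + d) ^ 2 / (2 * a) := by gcongr
          linarith
        · have hx2 : (x + d) ^ 2 = m' ^ 2 := by rw [hm', h, sq_abs]
          rw [hx2]
          have e1 : m' ^ 2 / (2 * b) ≤ m' ^ 2 / (2 * a) := by gcongr
          have e2 : m' ^ 2 / (2 * a') - m' ^ 2 / (2 * b)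
              + (a' + (q + d ^ 2) / a') / 2 - (b + (q + d ^ 2) / b) / 2
              = (a' - b) * (a' * b - (q + d ^ 2) - m' ^ 2) / (2 * a' * b) := by
            field_simp
            ring
          have e3 : (a' - b) * (a' * b - (q + d ^ 2) - m' ^ 2) / (2 * a' * b) ≤ 0 := by
            apply div_nonpos_of_nonpos_of_nonneg _ (by positivity)
            apply mul_nonpos_of_nonneg_of_nonpos (by linarith)
            have := mul_le_mul_of_nonneg_left hba' ha'
            linarith [sq a']
          linarith
      have hexp : (x + d) ^ 2 / (2 * a) = x ^ 2 / (2 * a) + x / a * d + d ^ 2 / a / 2 := by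
        field_simp
        ring
      linarith

lemma weight_step {g H d s s' x y m m' : ℝ} (hH : |H| ≤ 1) (hs : 0 ≤ s) (hs' : 0 ≤ s')
    (hsq : s' ^ 2 = s ^ 2 + d ^ 2) (hx : 0 ≤ x) (hy : 0 ≤ y) (hxm : x ≤ m) (hm' : m' = max m y) :
    (g + H * d) * y - 2 * (s' * m') - s' * (y ^ 2 / m') / 2
      ≤ g * x - 2 * (s * m) - s * (x ^ 2 / m) / 2 + (g - s * (x / m)) * (y - x) + x * H * d := by
  have hm : 0 ≤ m := hx.trans hxm
  have hmm' : m ≤ m' := hm' ▸ le_max_left _ _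
  have hym' : y ≤ m' := hm' ▸ le_max_right _ _
  have hss' : s ≤ s' := abs_le_of_sq_le_sq' (by nlinarith [sq_nonneg d]) hs' |>.2
  rcases (hm.trans hmm').eq_or_lt with h0 | hpos
  · obtain rfl : y = 0 := by linarith
    obtain rfl : x = 0 := by linarith
    obtain rfl : m = 0 := by linarith
    simp [← h0]
  have hbell : (y - x) ^ 2 / m' + 2 * (x / m) * (y - x)
      ≤ y ^ 2 / m' - x ^ 2 / m + 2 * (m' - m) := by
    rcases hm.eq_or_lt with h0 | hmpos
    · obtain rfl : x = 0 := by linarith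
      simp [← h0]
      linarith
    · have : y ^ 2 / m' - x ^ 2 / m + 2 * (m' - m)
          - ((y - x) ^ 2 / m' + 2 * (x / m) * (y - x)) =
          ((m' - m) * (x ^ 2 + 2 * m * m' - 2 * x * y)) / (m * m') := by
        field_simp
        ring
      have h2 : 0 ≤ ((m' - m) * (x ^ 2 + 2 * m * m' - 2 * x * y)) / (m * m') := by
        have : x * y ≤ m * m' := by gcongr
        have := sq_nonneg x
        apply div_nonneg _ (by positivity)
        apply mul_nonneg <;> nlinarith
      linarith
  have hD : |y - x| ≤ m' := abs_le.mpr ⟨by linarith, by linarith⟩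
  have hD2 : (y - x) ^ 2 / m' ≤ m' := by
    rw [div_le_iff₀ hpos, ← sq_abs, sq]
    gcongr
  have hcs : |d| * |y - x| ≤ s' * ((y - x) ^ 2 / m') / 2 + (s' - s) * m' := by
    rcases hs'.eq_or_lt with h0 | hs'pos
    · have hs0 : s = 0 := by linarith
      have : d = 0 := by
        have : d ^ 2 = 0 := by rw [← h0, hs0] at hsq; linarith
        simpa using this
      simp [this, ← h0, hs0]
    · have hsplit : s' * ((y - x) ^ 2 / m') / 2 + (s' - s) * m'
          = (s' ^ 2 * (y - x) ^ 2 + 2 * s' * (s' - s) * m' ^ 2) / (2 * s' * m') := by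
        field_simp
      rw [hsplit, le_div_iff₀ (by positivity)]
      have h1 := sq_nonneg (s' * |y - x| - |d| * m')
      have h2 : d ^ 2 * m' ^ 2 ≤ 2 * s' * (s' - s) * m' ^ 2 := by
        gcongr
        nlinarith
      rw [sub_sq, mul_pow, mul_pow, sq_abs, sq_abs] at h1
      linarith
  have hHd : H * d * (y - x) ≤ |d| * |y - x| := by
    refine (le_abs_self _).trans ?_
    rw [abs_mul, abs_mul]
    gcongr
    exact mul_le_of_le_one_left (abs_nonneg d) hH
  have k1 := mul_le_mul_of_nonneg_left hbell hs
  have k2 := mul_le_mul_of_nonneg_left hD2 (sub_nonneg.2 hss')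
  have k3 : 0 ≤ (s' - s) * (y ^ 2 / m') :=
    mul_nonneg (sub_nonneg.2 hss') (by positivity)
  have k4 : 0 ≤ s * (m' - m) := mul_nonneg hs (sub_nonneg.2 hmm')
  have k5 : 0 ≤ (s' - s) * m' := mul_nonneg (sub_nonneg.2 hss') hpos.le
  ring_nf at k1 k2 k3 k4 k5 hcs hHd ⊢
  linarith

section Pathwise

open Finset

/-- The partial square function of a real sequence. -/
noncomputable def sqFun (x : ℕ → ℝ) (n : ℕ) : ℝ := √(∑ k ∈ range n, (x (k + 1) - x k) ^ 2)

/-- The running maximum of the absolute values of a real sequence. -/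
noncomputable def maxFun (x : ℕ → ℝ) (n : ℕ) : ℝ := partialSups (fun k => |x k|) n

/-- The quantity `√(S² + M²)` combining square function and running maximum. -/
noncomputable def davisNorm (x : ℕ → ℝ) (n : ℕ) : ℝ := √(sqFun x n ^ 2 + maxFun x n ^ 2)

/-- The transform of a sequence by the bounded predictable multiplier `x / davisNorm x`. -/
noncomputable def davisTransform (x : ℕ → ℝ) (n : ℕ) : ℝ :=
  ∑ k ∈ range n, x k / davisNorm x k * (x (k + 1) - x k)

lemma sqFun_nonneg (x : ℕ → ℝ) (n : ℕ) : 0 ≤ sqFun x n := Real.sqrt_nonneg _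

lemma sqFun_sq (x : ℕ → ℝ) (n : ℕ) : sqFun x n ^ 2 = ∑ k ∈ range n, (x (k + 1) - x k) ^ 2 :=
  Real.sq_sqrt (sum_nonneg fun _ _ => sq_nonneg _)

lemma sqFun_succ_sq (x : ℕ → ℝ) (n : ℕ) :
    sqFun x (n + 1) ^ 2 = sqFun x n ^ 2 + (x (n + 1) - x n) ^ 2 := by
  rw [sqFun_sq, sqFun_sq, sum_range_succ]

lemma sqFun_le_sum_abs (x : ℕ → ℝ) (n : ℕ) :
    sqFun x n ≤ ∑ k ∈ range n, |x (k + 1) - x k| := by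
  induction n with
  | zero => simp [sqFun]
  | succ n ih =>
    rw [sum_range_succ]
    refine le_trans (?_ : _ ≤ sqFun x n + |x (n + 1) - x n|) (by gcongr)
    have h0 := mul_nonneg (sqFun_nonneg x n) (abs_nonneg (x (n + 1) - x n))
    refine (abs_le_of_sq_le_sq' ?_ (add_nonneg (sqFun_nonneg _ _) (abs_nonneg _))).2
    rw [sqFun_succ_sq, add_sq, sq_abs]
    linarith

lemma maxFun_succ (x : ℕ → ℝ) (n : ℕ) : maxFun x (n + 1) = max (maxFun x n) |x (n + 1)| :=
  partialSups_succ _ n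

lemma abs_le_maxFun (x : ℕ → ℝ) {k n : ℕ} (h : k ≤ n) : |x k| ≤ maxFun x n :=
  le_partialSups_of_le (fun k => |x k|) h

lemma maxFun_nonneg (x : ℕ → ℝ) (n : ℕ) : 0 ≤ maxFun x n :=
  (abs_nonneg _).trans (abs_le_maxFun x le_rfl)

lemma davisNorm_nonneg (x : ℕ → ℝ) (n : ℕ) : 0 ≤ davisNorm x n := Real.sqrt_nonneg _

lemma davisNorm_sq (x : ℕ → ℝ) (n : ℕ) :
    davisNorm x n ^ 2 = sqFun x n ^ 2 + maxFun x n ^ 2 :=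
  Real.sq_sqrt (by positivity)

lemma maxFun_le_davisNorm (x : ℕ → ℝ) (n : ℕ) : maxFun x n ≤ davisNorm x n :=
  Real.le_sqrt_of_sq_le (by linarith [sq_nonneg (sqFun x n)])

lemma abs_div_davisNorm_le_one (x : ℕ → ℝ) (n : ℕ) : |x n / davisNorm x n| ≤ 1 := by
  rw [abs_div, abs_of_nonneg (davisNorm_nonneg x n)]
  exact div_le_one_of_le₀ ((abs_le_maxFun x le_rfl).trans (maxFun_le_davisNorm x n))
    (davisNorm_nonneg x n)

lemma abs_davisTransform_le (x : ℕ → ℝ) (n : ℕ) :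
    |davisTransform x n| ≤ ∑ k ∈ range n, |x (k + 1) - x k| := by
  refine (abs_sum_le_sum_abs _ _).trans (sum_le_sum fun k _ => ?_)
  rw [abs_mul]
  exact mul_le_of_le_one_left (abs_nonneg _) (abs_div_davisNorm_le_one x k)

/-- A pathwise Davis inequality. -/
lemma maxFun_le (x : ℕ → ℝ) (h0 : x 0 = 0) (n : ℕ) :
    maxFun x n ≤ 24 * sqFun x n + 2 * davisTransform x n := by
  have key : ∀ n, x n ^ 2 / (2 * davisNorm x n)
      + (davisNorm x n + sqFun x n ^ 2 / davisNorm x n) / 2 - 12 * sqFun x n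
      ≤ davisTransform x n := by
    intro n
    induction n with
    | zero => simp [davisNorm, sqFun, maxFun, davisTransform, h0]
    | succ n ih =>
      have := davis_step (x := x n) (d := x (n + 1) - x n) (abs_le_maxFun x le_rfl)
        (m' := maxFun x (n + 1)) (by rw [maxFun_succ, add_sub_cancel])
        (sqFun_nonneg x n) (sqFun_nonneg x (n + 1)) (davisNorm_nonneg x n)
        (davisNorm_nonneg x (n + 1)) rfl (sqFun_succ_sq x n) (davisNorm_sq x n)
        (by rw [davisNorm_sq, sqFun_succ_sq])
      rw [← sqFun_succ_sq, add_sub_cancel] at this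
      have hT : davisTransform x (n + 1)
          = davisTransform x n + x n / davisNorm x n * (x (n + 1) - x n) := sum_range_succ _ _
      linarith
  have h1 : 0 ≤ x n ^ 2 / (2 * davisNorm x n) :=
    div_nonneg (sq_nonneg _) (by linarith [davisNorm_nonneg x n])
  have h2 : 0 ≤ sqFun x n ^ 2 / davisNorm x n := div_nonneg (sq_nonneg _) (davisNorm_nonneg x n)
  linarith [key n, maxFun_le_davisNorm x n]

end Pathwise

section Measurability

variable {Ω : Type*} {m : MeasurableSpace Ω} {f : ℕ → Ω → ℝ} {n : ℕ}

lemma measurable_maxFun (hf : ∀ k ≤ n, Measurable (f k)) :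
    Measurable fun ω => maxFun (f · ω) n := by
  induction n with
  | zero => simpa [maxFun] using (hf 0 le_rfl).abs
  | succ n ih =>
    simp only [maxFun_succ]
    exact (ih fun k hk => hf k (hk.trans n.le_succ)).max (hf _ le_rfl).abs

lemma measurable_sqFun (hf : ∀ k ≤ n, Measurable (f k)) :
    Measurable fun ω => sqFun (f · ω) n := by
  refine (Finset.measurable_fun_sum _ fun k hk => ?_).sqrt
  have hk := Finset.mem_range.1 hk
  exact ((hf (k + 1) hk).sub (hf k hk.le)).pow_const 2

lemma measurable_div_davisNorm (hf : ∀ k ≤ n, Measurable (f k)) :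
    Measurable fun ω => f n ω / davisNorm (f · ω) n :=
  (hf n le_rfl).div
    (((measurable_sqFun hf).pow_const 2).add ((measurable_maxFun hf).pow_const 2)).sqrt

lemma measurable_davisTransform (hf : ∀ k ≤ n, Measurable (f k)) :
    Measurable fun ω => davisTransform (f · ω) n := by
  refine Finset.measurable_fun_sum _ fun k hk => ?_
  have hk := Finset.mem_range.1 hk
  exact (measurable_div_davisNorm fun j hj => hf j (hj.trans hk.le)).mul
    ((hf (k + 1) hk).sub (hf k hk.le))

end Measurability

section Martingale

variable {Ω : Type*} {mΩ : MeasurableSpace Ω} {μ : Measure Ω}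
  {ℱ : Filtration ℕ mΩ} {f v : ℕ → Ω → ℝ}

lemma MeasureTheory.Martingale.measurable_le (hf : Martingale f ℱ μ) {k n : ℕ} (h : k ≤ n) :
    Measurable[ℱ n] (f k) :=
  (hf.stronglyMeasurable k).measurable.mono (ℱ.mono h) le_rfl

lemma integral_mul_condExp [IsFiniteMeasure μ] {m : MeasurableSpace Ω} (hm : m ≤ mΩ)
    {A X : Ω → ℝ} (hA : Measurable[m] A) (hX : Integrable X μ)
    (hAX : Integrable (fun ω => A ω * X ω) μ) :
    ∫ ω, A ω * (μ[X | m]) ω ∂μ = ∫ ω, A ω * X ω ∂μ := by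
  rw [← integral_condExp hm (f := fun ω => A ω * X ω)]
  exact integral_congr_ae
    (condExp_mul_of_stronglyMeasurable_left hA.stronglyMeasurable hAX hX).symm

lemma MeasureTheory.Martingale.integral_mul_sub_eq_zero [IsFiniteMeasure μ]
    (hf : Martingale f ℱ μ) {n : ℕ} {A : Ω → ℝ} (hA : Measurable[ℱ n] A)
    (h1 : Integrable (fun ω => A ω * f (n + 1) ω) μ)
    (h0 : Integrable (fun ω => A ω * f n ω) μ) :
    ∫ ω, A ω * (f (n + 1) ω - f n ω) ∂μ = 0 := by
  simp only [mul_sub]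
  rw [integral_sub h1 h0, ← integral_mul_condExp (ℱ.le n) hA (hf.integrable _) h1, sub_eq_zero]
  refine integral_congr_ae ?_
  filter_upwards [hf.2 n (n + 1) n.le_succ] with ω hω
  rw [hω]

lemma MeasureTheory.Martingale.integrable_sum_abs_sub (hf : Martingale f ℱ μ) (n : ℕ) :
    Integrable (fun ω => ∑ k ∈ Finset.range n, |f (k + 1) ω - f k ω|) μ :=
  integrable_finsetSum _ fun k _ => ((hf.integrable (k + 1)).sub (hf.integrable k)).abs

lemma MeasureTheory.Martingale.integrable_sqFun (hf : Martingale f ℱ μ) (n : ℕ) :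
    Integrable (fun ω => sqFun (f · ω) n) μ :=
  (hf.integrable_sum_abs_sub n).mono'
    (measurable_sqFun fun k _ => (hf.measurable_le le_rfl).mono (ℱ.le k) le_rfl).aestronglyMeasurable
    (ae_of_all _ fun ω => by
      rw [Real.norm_of_nonneg (sqFun_nonneg _ _)]
      exact sqFun_le_sum_abs _ n)

lemma MeasureTheory.Martingale.integrable_davisTransform (hf : Martingale f ℱ μ) (n : ℕ) :
    Integrable (fun ω => davisTransform (f · ω) n) μ :=
  (hf.integrable_sum_abs_sub n).mono'
    (measurable_davisTransform fun k _ =>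
      (hf.measurable_le le_rfl).mono (ℱ.le k) le_rfl).aestronglyMeasurable
    (ae_of_all _ fun _ => abs_davisTransform_le _ n)

lemma MeasureTheory.Martingale.integrable_maxFun (hf : Martingale f ℱ μ) (n : ℕ) :
    Integrable (fun ω => maxFun (f · ω) n) μ := by
  induction n with
  | zero => simpa [maxFun] using (hf.integrable 0).abs
  | succ n ih =>
    simp only [maxFun_succ]
    exact ih.sup (hf.integrable _).abs

lemma Measurable.integrable_mul_of_abs_le {X Z : Ω → ℝ} {c : ℝ} (hX : Integrable X μ)
    (hZ : Measurable Z) (hc : ∀ ω, |Z ω| ≤ c) : Integrable (fun ω => X ω * Z ω) μ :=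
  hX.mul_bdd hZ.aestronglyMeasurable (ae_of_all _ hc)

lemma maxFun_le_of_abs_le {x : ℕ → ℝ} {c : ℝ} (h : ∀ k, |x k| ≤ c) (n : ℕ) : maxFun x n ≤ c :=
  partialSups_le _ _ _ fun k _ => h k

/-- Weighted `H¹`-`BMO` type duality for the Davis transform. -/
lemma MeasureTheory.Martingale.integral_davisTransform_mul_le [IsFiniteMeasure μ]
    (hf : Martingale f ℱ μ) (hv : Martingale v ℱ μ) {c : ℝ} (hv0 : ∀ n ω, 0 ≤ v n ω)
    (hvc : ∀ n ω, v n ω ≤ c) (n : ℕ) :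
    ∫ ω, davisTransform (f · ω) n * v n ω ∂μ
      ≤ 5 / 2 * ∫ ω, sqFun (f · ω) n * maxFun (v · ω) n ∂μ := by
  have habs : ∀ n ω, |v n ω| = v n ω := fun n ω => abs_of_nonneg (hv0 n ω)
  have hvM : ∀ n ω, v n ω ≤ maxFun (v · ω) n := fun n ω =>
    (le_abs_self _).trans (abs_le_maxFun (v · ω) le_rfl)
  have hMc : ∀ n ω, maxFun (v · ω) n ≤ c := fun n ω =>
    maxFun_le_of_abs_le (fun k => (habs k ω).trans_le (hvc k ω)) n
  have hquot : ∀ n ω, |v n ω / maxFun (v · ω) n| ≤ 1 := fun n ω => by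
    rw [abs_of_nonneg (div_nonneg (hv0 n ω) (maxFun_nonneg _ n))]
    exact div_le_one_of_le₀ (hvM n ω) (maxFun_nonneg _ n)
  have hquot2 : ∀ n ω, v n ω ^ 2 / maxFun (v · ω) n ≤ maxFun (v · ω) n := fun n ω => by
    have h := maxFun_nonneg (v · ω) n
    apply div_le_of_le_mul₀ h h
    rw [sq]
    exact mul_le_mul (hvM n ω) (hvM n ω) (hv0 n ω) h
  have hquot20 : ∀ n ω, 0 ≤ v n ω ^ 2 / maxFun (v · ω) n := fun n ω =>
    div_nonneg (sq_nonneg _) (maxFun_nonneg _ n)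
  have mf : ∀ k, Measurable (f k) := fun k => (hf.measurable_le le_rfl).mono (ℱ.le k) le_rfl
  have mv : ∀ k, Measurable (v k) := fun k => (hv.measurable_le le_rfl).mono (ℱ.le k) le_rfl
  have mM : ∀ n, Measurable fun ω => maxFun (v · ω) n := fun n =>
    measurable_maxFun fun k _ => mv k
  have i1 : ∀ n, Integrable (fun ω => davisTransform (f · ω) n * v n ω) μ := fun n =>
    (mv n).integrable_mul_of_abs_le (hf.integrable_davisTransform n)
      fun ω => (habs n ω).trans_le (hvc n ω)
  have i2 : ∀ n, Integrable (fun ω => sqFun (f · ω) n * maxFun (v · ω) n) μ := fun n =>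
    (mM n).integrable_mul_of_abs_le (hf.integrable_sqFun n) fun ω => by
      rw [abs_of_nonneg (maxFun_nonneg _ n)]
      exact hMc n ω
  have i3 : ∀ n, Integrable
      (fun ω => sqFun (f · ω) n * (v n ω ^ 2 / maxFun (v · ω) n)) μ := fun n =>
    (((mv n).pow_const 2).div (mM n)).integrable_mul_of_abs_le (hf.integrable_sqFun n) fun ω => by
      change |v n ω ^ 2 / maxFun (v · ω) n| ≤ c
      rw [abs_of_nonneg (hquot20 n ω)]
      exact (hquot2 n ω).trans (hMc n ω)
  let Y : ℕ → Ω → ℝ := fun n ω => davisTransform (f · ω) n * v n ω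
    - 2 * (sqFun (f · ω) n * maxFun (v · ω) n)
    - sqFun (f · ω) n * (v n ω ^ 2 / maxFun (v · ω) n) / 2
  have iY : ∀ n, Integrable (Y n) μ := fun n =>
    ((i1 n).sub ((i2 n).const_mul 2)).sub ((i3 n).div_const 2)
  have hY : ∫ ω, Y n ω ∂μ ≤ 0 := by
    induction n with
    | zero => simp [Y, davisTransform, sqFun]
    | succ n ih =>
      let A : Ω → ℝ := fun ω =>
        davisTransform (f · ω) n - sqFun (f · ω) n * (v n ω / maxFun (v · ω) n)
      let B : Ω → ℝ := fun ω => v n ω * (f n ω / davisNorm (f · ω) n)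
      have hA : Measurable[ℱ n] A :=
        (measurable_davisTransform fun k hk => hf.measurable_le hk).sub
          ((measurable_sqFun fun k hk => hf.measurable_le hk).mul
            ((hv.measurable_le le_rfl).div (measurable_maxFun fun k hk => hv.measurable_le hk)))
      have hB : Measurable[ℱ n] B :=
        (hv.measurable_le le_rfl).mul (measurable_div_davisNorm fun k hk => hf.measurable_le hk)
      have iA : Integrable A μ := (hf.integrable_davisTransform n).sub
        (((mv n).div (mM n)).integrable_mul_of_abs_le (hf.integrable_sqFun n) (hquot n))
      have hBc : ∀ ω, |B ω| ≤ c := fun ω => by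
        simp only [B]
        rw [abs_mul, habs]
        exact (mul_le_of_le_one_right (hv0 n ω) (abs_div_davisNorm_le_one (f · ω) n)).trans
          (hvc n ω)
      have iAv : ∀ k, Integrable (fun ω => A ω * v k ω) μ := fun k =>
        (mv k).integrable_mul_of_abs_le iA fun ω => (habs k ω).trans_le (hvc k ω)
      have iBf : ∀ k, Integrable (fun ω => B ω * f k ω) μ := fun k => by
        simpa only [mul_comm] using
          (hB.mono (ℱ.le n) le_rfl).integrable_mul_of_abs_le (hf.integrable k) hBc
      have iA' : Integrable (fun ω => A ω * (v (n + 1) ω - v n ω)) μ := by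
        simp only [mul_sub]
        exact (iAv (n + 1)).sub (iAv n)
      have iB' : Integrable (fun ω => B ω * (f (n + 1) ω - f n ω)) μ := by
        simp only [mul_sub]
        exact (iBf (n + 1)).sub (iBf n)
      have hstep : ∀ ω, Y (n + 1) ω ≤ Y n ω + A ω * (v (n + 1) ω - v n ω)
          + B ω * (f (n + 1) ω - f n ω) := fun ω => by
        have hT : davisTransform (f · ω) (n + 1) = davisTransform (f · ω) n
          + f n ω / davisNorm (f · ω) n * (f (n + 1) ω - f n ω) := Finset.sum_range_succ _ _
        have := weight_step (g := davisTransform (f · ω) n)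
          (abs_div_davisNorm_le_one (f · ω) n) (sqFun_nonneg (f · ω) n)
          (sqFun_nonneg (f · ω) (n + 1)) (sqFun_succ_sq (f · ω) n) (hv0 n ω) (hv0 (n + 1) ω)
          (hvM n ω) (m' := maxFun (v · ω) (n + 1)) (by rw [maxFun_succ, habs])
        simp only [Y, A, B, hT]
        exact this
      calc ∫ ω, Y (n + 1) ω ∂μ
          ≤ ∫ ω, (Y n ω + A ω * (v (n + 1) ω - v n ω) + B ω * (f (n + 1) ω - f n ω)) ∂μ :=
            integral_mono (iY _) (((iY n).add iA').add iB') hstep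
        _ = ∫ ω, Y n ω ∂μ := by
            have iYA : Integrable (fun ω => Y n ω + A ω * (v (n + 1) ω - v n ω)) μ :=
              (iY n).add iA'
            rw [integral_add iYA iB', integral_add (iY n) iA',
              hv.integral_mul_sub_eq_zero hA (iAv _) (iAv _),
              hf.integral_mul_sub_eq_zero hB (iBf _) (iBf _), add_zero, add_zero]
        _ ≤ 0 := ih
  have hfin : ∀ ω, davisTransform (f · ω) n * v n ω
      ≤ Y n ω + 5 / 2 * (sqFun (f · ω) n * maxFun (v · ω) n) := fun ω => by
    have := mul_le_mul_of_nonneg_left (hquot2 n ω) (sqFun_nonneg (f · ω) n)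
    simp only [Y]
    linarith
  calc ∫ ω, davisTransform (f · ω) n * v n ω ∂μ
      ≤ ∫ ω, (Y n ω + 5 / 2 * (sqFun (f · ω) n * maxFun (v · ω) n)) ∂μ :=
        integral_mono (i1 n) ((iY n).add ((i2 n).const_mul _)) hfin
    _ = ∫ ω, Y n ω ∂μ + 5 / 2 * ∫ ω, sqFun (f · ω) n * maxFun (v · ω) n ∂μ := by
        rw [integral_add (iY n) ((i2 n).const_mul _), integral_const_mul]
    _ ≤ _ := by linarith

/-- Weighted Davis inequality for bounded nonnegative martingale weights. -/
lemma MeasureTheory.Martingale.integral_maxFun_mul_le [IsFiniteMeasure μ]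
    (hf : Martingale f ℱ μ) (hf0 : ∀ ω, f 0 ω = 0) (hv : Martingale v ℱ μ) {c : ℝ}
    (hv0 : ∀ n ω, 0 ≤ v n ω) (hvc : ∀ n ω, v n ω ≤ c) (n : ℕ) :
    Integrable (fun ω => sqFun (f · ω) n * maxFun (v · ω) n) μ ∧
    ∫ ω, maxFun (f · ω) n * v n ω ∂μ ≤ 29 * ∫ ω, sqFun (f · ω) n * maxFun (v · ω) n ∂μ := by
  have habs : ∀ n ω, |v n ω| = v n ω := fun n ω => abs_of_nonneg (hv0 n ω)
  have hvc' : ∀ n ω, |v n ω| ≤ c := fun n ω => (habs n ω).trans_le (hvc n ω)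
  have mv : ∀ k, Measurable (v k) := fun k => (hv.measurable_le le_rfl).mono (ℱ.le k) le_rfl
  have i1 := (mv n).integrable_mul_of_abs_le (hf.integrable_davisTransform n) (hvc' n)
  have i2 : Integrable (fun ω => sqFun (f · ω) n * maxFun (v · ω) n) μ :=
    (measurable_maxFun fun k _ => mv k).integrable_mul_of_abs_le (hf.integrable_sqFun n)
      (c := c) fun ω => by
        rw [abs_of_nonneg (maxFun_nonneg _ n)]
        exact maxFun_le_of_abs_le (fun k => hvc' k ω) n
  have i3 := (mv n).integrable_mul_of_abs_le (hf.integrable_maxFun n) (hvc' n)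
  refine ⟨i2, ?_⟩
  have hpt : ∀ ω, maxFun (f · ω) n * v n ω
      ≤ 24 * (sqFun (f · ω) n * maxFun (v · ω) n) + 2 * (davisTransform (f · ω) n * v n ω) :=
    fun ω => by
      have h1 := mul_le_mul_of_nonneg_right (maxFun_le (f · ω) (hf0 ω) n) (hv0 n ω)
      have h2 : v n ω ≤ maxFun (v · ω) n :=
        (le_abs_self _).trans (abs_le_maxFun (v · ω) le_rfl)
      have h3 := mul_le_mul_of_nonneg_left h2 (sqFun_nonneg (f · ω) n)
      linarith
  have h := integral_mono i3 ((i2.const_mul 24).add (i1.const_mul 2)) hpt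
  simp only [Pi.add_apply] at h
  rw [integral_add (i2.const_mul 24) (i1.const_mul 2), integral_const_mul, integral_const_mul] at h
  linarith [hf.integral_davisTransform_mul_le hv hv0 hvc n]

/-- A version of the closed martingale of a function with values in `[0, c]` which takes values
in `[0, c]` everywhere. -/
lemma exists_martingale_mem_Icc [IsFiniteMeasure μ] (ℱ : Filtration ℕ mΩ) {u : Ω → ℝ} {c : ℝ}
    (hui : Integrable u μ) (hu0 : ∀ ω, 0 ≤ u ω) (huc : ∀ ω, u ω ≤ c) (hc : 0 ≤ c) :
    ∃ v : ℕ → Ω → ℝ, Martingale v ℱ μ ∧ (∀ n ω, 0 ≤ v n ω) ∧ (∀ n ω, v n ω ≤ c) ∧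
      ∀ n, v n =ᵐ[μ] μ[u | ℱ n] := by
  have hae : ∀ n, (fun ω => max 0 (min c ((μ[u | ℱ n]) ω))) =ᵐ[μ] μ[u | ℱ n] := fun n => by
    have h0 : 0 ≤ᵐ[μ] μ[u | ℱ n] := condExp_nonneg (ae_of_all _ hu0)
    have h1 : μ[u | ℱ n] ≤ᵐ[μ] μ[fun _ => c | ℱ n] :=
      condExp_mono hui (integrable_const c) (ae_of_all _ huc)
    rw [condExp_const (ℱ.le n)] at h1
    filter_upwards [h0, h1] with ω h0 h1
    rw [min_eq_right h1, max_eq_right (by exact h0)]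
  refine ⟨fun n ω => max 0 (min c ((μ[u | ℱ n]) ω)), ⟨fun n => ?_, fun i j hij => ?_⟩,
    fun n ω => le_max_left _ _, fun n ω => max_le hc (min_le_left _ _), hae⟩
  · exact (measurable_const.max
      (measurable_const.min stronglyMeasurable_condExp.measurable)).stronglyMeasurable
  · exact (condExp_congr_ae (hae j)).trans
      (((martingale_condExp u ℱ μ).2 i j hij).trans (hae i).symm)

end Martingale

/-- weighted Burkholder–Davis–Gundy inequality:
`E[Mf · w] ≤ 16(√2+1) E[Sf · Mw]` where `Mf = sup_n |f_n|`,
`Sf = (Σ_n |df_n|²)^{1/2}` and `Mw = sup_n E[w | ℱ_n]`. -/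
theorem weighted_BDG
    {Ω : Type*} {mΩ : MeasurableSpace Ω} {μ : Measure Ω} [IsProbabilityMeasure μ]
    (ℱ : Filtration ℕ mΩ) (f : ℕ → Ω → ℝ)
    (hf : Martingale f ℱ μ) (hf0 : ∀ ω, f 0 ω = 0)
    (w : Ω → ℝ) (hw : ∀ ω, 0 ≤ w ω) (hwi : Integrable w μ) :
    ∫⁻ ω, (⨆ n : ℕ, ENNReal.ofReal |f n ω|) * ENNReal.ofReal (w ω) ∂μ
      ≤ ENNReal.ofReal (16 * (Real.sqrt 2 + 1)) *
          ∫⁻ ω, (∑' n : ℕ, ENNReal.ofReal ((f (n + 1) ω - f n ω) ^ 2)) ^ ((2 : ℝ)⁻¹)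
              * ⨆ n : ℕ, ENNReal.ofReal ((μ[w | ℱ n]) ω) ∂μ := by
  have mf : ∀ k, Measurable (f k) := fun k => (hf.measurable_le le_rfl).mono (ℱ.le k) le_rfl
  let u : ℕ → Ω → ℝ := fun N ω => min (w ω) N
  have hu0 : ∀ N ω, 0 ≤ u N ω := fun N ω => le_min (hw ω) N.cast_nonneg
  have hui : ∀ N, Integrable (u N) μ := fun N => hwi.inf (integrable_const _)
  have hmono : ∀ ω, Monotone fun N => ENNReal.ofReal (maxFun (f · ω) N * u N ω) :=
    fun ω N N' h => by
      refine ENNReal.ofReal_le_ofReal (mul_le_mul ?_ ?_ (hu0 _ _) (maxFun_nonneg _ _))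
      · exact (partialSups _).monotone h
      · exact min_le_min_left _ (Nat.cast_le.2 h)
  have hmeas : ∀ N, AEMeasurable (fun ω => ENNReal.ofReal (maxFun (f · ω) N * u N ω)) μ :=
    fun N => ((measurable_maxFun fun k _ => mf k).aemeasurable.mul
      (hui N).aemeasurable).ennreal_ofReal
  have hpt : ∀ ω, (⨆ n : ℕ, ENNReal.ofReal |f n ω|) * ENNReal.ofReal (w ω)
      ≤ ⨆ N, ENNReal.ofReal (maxFun (f · ω) N * u N ω) := fun ω => by
    rw [ENNReal.iSup_mul]
    refine iSup_le fun n => ?_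
    obtain ⟨N, hN⟩ := exists_nat_ge (w ω)
    refine le_trans ?_ (le_iSup _ (max n N))
    rw [← ENNReal.ofReal_mul (abs_nonneg _)]
    refine ENNReal.ofReal_le_ofReal (mul_le_mul (abs_le_maxFun (f · ω) (le_max_left n N)) ?_
      (hw ω) (maxFun_nonneg _ _))
    exact le_min le_rfl (hN.trans (Nat.cast_le.2 (le_max_right n N)))
  refine (lintegral_mono hpt).trans ?_
  rw [lintegral_iSup' hmeas (ae_of_all _ hmono)]
  refine iSup_le fun N => ?_
  obtain ⟨v, hv, hv0, hvc, hvu⟩ := exists_martingale_mem_Icc ℱ (hui N) (hu0 N)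
    (fun ω => min_le_right _ _) N.cast_nonneg
  obtain ⟨hint, hle⟩ := hf.integral_maxFun_mul_le hf0 hv hv0 hvc N
  have hint' : Integrable (fun ω => maxFun (f · ω) N * u N ω) μ :=
    (hf.integrable_maxFun N).mul_bdd (c := N) (hui N).aestronglyMeasurable
      (ae_of_all _ fun ω => by
        rw [Real.norm_of_nonneg (hu0 N ω)]
        exact min_le_right _ _)
  have heq : ∫ ω, maxFun (f · ω) N * v N ω ∂μ = ∫ ω, maxFun (f · ω) N * u N ω ∂μ := by
    rw [← integral_mul_condExp (ℱ.le N) (measurable_maxFun fun k hk => hf.measurable_le hk)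
      (hui N) hint']
    refine integral_congr_ae ?_
    filter_upwards [hvu N] with ω hω
    rw [hω]
  have hconst : (29 : ℝ) ≤ 16 * (√2 + 1) := by
    have : (1 : ℝ) ≤ √2 := Real.one_le_sqrt.2 one_le_two
    linarith
  have hvw : ∀ᵐ ω ∂μ, ∀ n, v n ω ≤ (μ[w | ℱ n]) ω := by
    refine ae_all_iff.2 fun n => ?_
    have h1 : μ[u N | ℱ n] ≤ᵐ[μ] μ[w | ℱ n] :=
      condExp_mono (hui N) hwi (ae_of_all _ fun ω => min_le_left _ _)
    filter_upwards [hvu n, h1] with ω h h1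
    rw [h]
    exact h1
  rw [← ofReal_integral_eq_lintegral_ofReal hint'
    (ae_of_all _ fun ω => mul_nonneg (maxFun_nonneg _ _) (hu0 N ω)), ← heq]
  have hSM0 : ∀ ω, 0 ≤ sqFun (f · ω) N * maxFun (v · ω) N := fun ω =>
    mul_nonneg (sqFun_nonneg _ _) (maxFun_nonneg _ _)
  refine (ENNReal.ofReal_le_ofReal (hle.trans
    (mul_le_mul_of_nonneg_right hconst (integral_nonneg hSM0)))).trans ?_
  rw [ENNReal.ofReal_mul (by positivity),
    ofReal_integral_eq_lintegral_ofReal hint (ae_of_all _ hSM0)]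
  refine mul_le_mul_right (lintegral_mono_ae ?_) _
  filter_upwards [hvw] with ω hω
  rw [ENNReal.ofReal_mul (sqFun_nonneg _ _)]
  refine mul_le_mul' ?_ ?_
  · rw [sqFun, Real.sqrt_eq_rpow, one_div,
      ← ENNReal.ofReal_rpow_of_nonneg (Finset.sum_nonneg fun _ _ => sq_nonneg _) (by norm_num),
      ENNReal.ofReal_sum_of_nonneg fun _ _ => sq_nonneg _]
    exact ENNReal.rpow_le_rpow (ENNReal.sum_le_tsum _) (by norm_num)
  · obtain ⟨k, -, hk⟩ : ∃ k ≤ N, maxFun (v · ω) N = |v k ω| := by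
      obtain ⟨k, hk, h⟩ := exists_partialSups_eq (fun k => |v k ω|) N
      exact ⟨k, hk, h⟩
    rw [hk, abs_of_nonneg (hv0 k ω)]
    exact (ENNReal.ofReal_le_ofReal (hω k)).trans
      (le_iSup (fun n => ENNReal.ofReal ((μ[w | ℱ n]) ω)) k)
end
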